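/- Let S = R ∪ B be a bicolored point set in general position with |R| = |B| = n ≥ 2. Then there exists a 1-plane Hamiltonian alternating cycle on S with at most n − max{r(S), b(S)} crossings. -/

import Mathlib

open scoped Classical

noncomputable section

/-- Points of the plane. -/
abbrev Pt := ℝ × ℝ

/-- Orientation determinant of the ordered triple `(a, b, c)`. -/
def det2 (a b c : Pt) : ℝ :=
  (b.1 - a.1) * (c.2 - a.2) - (b.2 - a.2) * (c.1 - a.1)

/-- Two closed segments cross: some point lies in the relative interior of both. -/
def SegCross (e f : Pt × Pt) : Prop :=
  ∃ x : Pt, x ∈ openSegment ℝ e.1 e.2 ∧ x ∈ openSegment ℝ f.1 f.2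

/-- Number of crossings (unordered pairs of crossing edges) among a list of edges. -/
def crossNum (es : List (Pt × Pt)) : ℕ :=
  ((Finset.range es.length ×ˢ Finset.range es.length).filter
    (fun ij => ij.1 < ij.2 ∧
      SegCross (es.getD ij.1 ((0, 0), (0, 0))) (es.getD ij.2 ((0, 0), (0, 0))))).card

/-- Number of other edges crossing the `i`-th edge of the list. -/
def edgeCrossCount (es : List (Pt × Pt)) (i : ℕ) : ℕ :=
  ((Finset.range es.length).filter (fun j => j ≠ i ∧
      SegCross (es.getD i ((0, 0), (0, 0))) (es.getD j ((0, 0), (0, 0))))).card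

/-- Every edge is crossed by at most one other edge. -/
def OnePlane (es : List (Pt × Pt)) : Prop :=
  ∀ i ∈ Finset.range es.length, edgeCrossCount es i ≤ 1

/-- The edges of a path given by its list of vertices. -/
def pathEdges (l : List Pt) : List (Pt × Pt) := l.zip l.tail

/-- The edges of a cycle given by its list of vertices (including the wrap-around edge). -/
def cycleEdges (l : List Pt) : List (Pt × Pt) := l.zip (l.rotate 1)

/-- An edge joining a point of `R` to a point of `B`. -/
def Bichromatic (R B : Finset Pt) (e : Pt × Pt) : Prop :=
  (e.1 ∈ R ∧ e.2 ∈ B) ∨ (e.1 ∈ B ∧ e.2 ∈ R)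

/-- A Hamiltonian alternating path on the bicolored point set `R ∪ B`
with endpoints `p` and `q`. -/
structure HamAltPath (R B : Finset Pt) (p q : Pt) where
  verts : List Pt
  nodup : verts.Nodup
  cover : verts.toFinset = R ∪ B
  head_eq : verts.head? = some p
  last_eq : verts.getLast? = some q
  alt : ∀ e ∈ pathEdges verts, Bichromatic R B e

/-- A Hamiltonian alternating cycle on the bicolored point set `R ∪ B`. -/
structure HamAltCycle (R B : Finset Pt) where
  verts : List Pt
  nodup : verts.Nodup
  cover : verts.toFinset = R ∪ B
  alt : ∀ e ∈ cycleEdges verts, Bichromatic R B e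

/-- A Hamiltonian alternating path with prescribed endpoints is optimum if it has the
minimum number of crossings among all such paths. -/
def OptimumPath (R B : Finset Pt) (p q : Pt) (P : HamAltPath R B p q) : Prop :=
  ∀ Q : HamAltPath R B p q, crossNum (pathEdges P.verts) ≤ crossNum (pathEdges Q.verts)

/-- No three points of `S` are collinear. -/
def GeneralPosition (S : Finset Pt) : Prop :=
  ∀ p ∈ S, ∀ q ∈ S, ∀ r ∈ S, p ≠ q → p ≠ r → q ≠ r → ¬ Collinear ℝ ({p, q, r} : Set Pt)

/-- Every point of `S` is a vertex (extreme point) of its convex hull. -/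
def ConvexPosition (S : Finset Pt) : Prop :=
  ∀ p ∈ S, p ∉ convexHull ℝ ((S.erase p : Finset Pt) : Set Pt)

/-- The points of `S` lying on the boundary of the convex hull of `S`
(i.e. the extreme points of `S`). -/
def hullPts (S : Finset Pt) : Finset Pt :=
  S.filter fun p => p ∉ convexHull ℝ ((S.erase p : Finset Pt) : Set Pt)

/-- Cyclic successor on `Fin m`. -/
def cycSucc {m : ℕ} (hm : 0 < m) (i : Fin m) : Fin m :=
  ⟨(i.val + 1) % m, Nat.mod_lt _ hm⟩

/-- Cyclic predecessor on `Fin m`. -/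
def cycPred {m : ℕ} (hm : 0 < m) (i : Fin m) : Fin m :=
  ⟨(i.val + (m - 1)) % m, Nat.mod_lt _ hm⟩

/-- `pt` lists points in convex position, in clockwise circular order:
every index-increasing triple is clockwise oriented. -/
def CWList {m : ℕ} (pt : Fin m → Pt) : Prop :=
  Function.Injective pt ∧
    ∀ i j k : Fin m, i < j → j < k → det2 (pt i) (pt j) (pt k) < 0

/-- `pt` is a clockwise listing of the points of `S` on the boundary of `CH(S)`. -/
def IsHullList (S : Finset Pt) {m : ℕ} (pt : Fin m → Pt) : Prop :=
  CWList pt ∧ Finset.univ.image pt = hullPts S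

/-- The number of runs of color `A` (with other color `C`) in the cyclic sequence `pt`:
a run starts at an `A`-point whose cyclic predecessor is a `C`-point; a completely
`A`-colored cycle forms a single run. -/
def runCount {m : ℕ} (hm : 0 < m) (A C : Finset Pt) (pt : Fin m → Pt) : ℕ :=
  if ∀ i : Fin m, pt i ∈ A then 1
  else (Finset.univ.filter fun i : Fin m => pt i ∈ A ∧ pt (cycPred hm i) ∈ C).card

/-- `q` is the counterclockwise radial order of the points of `T` around `r`. -/
def CCWOrder (r : Pt) {k : ℕ} (q : Fin k → Pt) (T : Finset Pt) : Prop :=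
  Function.Injective q ∧ Finset.univ.image q = T ∧
    ∀ i j : Fin k, i < j → 0 < det2 r (q i) (q j)

/-- `q` is the clockwise radial order of the points of `T` around `r`. -/
def CWOrder (r : Pt) {k : ℕ} (q : Fin k → Pt) (T : Finset Pt) : Prop :=
  Function.Injective q ∧ Finset.univ.image q = T ∧
    ∀ i j : Fin k, i < j → det2 r (q i) (q j) < 0

/-- Counting one extra point of color `A` (the center), the initial segment
`q 0, …, q j` contains equally many points of color `A` and of color `C`. -/
def BalancedAt (A C : Finset Pt) {k : ℕ} (q : Fin k → Pt) (j : Fin k) : Prop :=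
  1 + (Finset.univ.filter fun i : Fin k => i ≤ j ∧ q i ∈ A).card
    = (Finset.univ.filter fun i : Fin k => i ≤ j ∧ q i ∈ C).card

/-- `j` is the first balanced index of the sequence `q`. -/
def FirstBalanced (A C : Finset Pt) {k : ℕ} (q : Fin k → Pt) (j : Fin k) : Prop :=
  BalancedAt A C q j ∧ ∀ j' : Fin k, j' < j → ¬ BalancedAt A C q j'

/-- The triple `(R ∪ B, r, b)` is a special configuration (Definition 2.2):
(i) both neighbors of `r` on the hull boundary are red and both neighbors of `b` are
blue; (ii) in the counterclockwise and clockwise radial orders around `r`, the first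
balanced point is `b`; (iii) symmetrically around `b`, the first balanced point is `r`. -/
def SpecialConfig (R B : Finset Pt) (r b : Pt) : Prop :=
  r ∈ hullPts (R ∪ B) ∧ b ∈ hullPts (R ∪ B) ∧
  (∀ (m : ℕ) (hm : 0 < m) (pt : Fin m → Pt), IsHullList (R ∪ B) pt →
    ∀ i : Fin m,
      (pt i = r → pt (cycPred hm i) ∈ R ∧ pt (cycSucc hm i) ∈ R) ∧
      (pt i = b → pt (cycPred hm i) ∈ B ∧ pt (cycSucc hm i) ∈ B)) ∧
  (∀ (k : ℕ) (q : Fin k → Pt),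
      (CCWOrder r q ((R ∪ B).erase r) ∨ CWOrder r q ((R ∪ B).erase r)) →
      ∀ j : Fin k, FirstBalanced R B q j → q j = b) ∧
  (∀ (k : ℕ) (q : Fin k → Pt),
      (CCWOrder b q ((R ∪ B).erase b) ∨ CWOrder b q ((R ∪ B).erase b)) →
      ∀ j : Fin k, FirstBalanced B R q j → q j = r)

/-- The unordered pair `{a, b}` occurs as an edge of the list `es`. -/
def IsEdgeOf (es : List (Pt × Pt)) (a b : Pt) : Prop := (a, b) ∈ es ∨ (b, a) ∈ es

/-- The clockwise cyclic interval of indices from `a` to `b`, inclusive. -/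
def cycIdx {m : ℕ} (hm : 0 < m) (a b : Fin m) : Finset (Fin m) :=
  (Finset.range ((b.val + m - a.val) % m + 1)).image
    fun t => (⟨(a.val + t) % m, Nat.mod_lt _ hm⟩ : Fin m)

/-! ### Orientations, extreme points and angular orders -/

/-- The orientation determinant multiplied by a sign `ε`. -/
def odet (ε : ℝ) (a b c : Pt) : ℝ := ε * det2 a b c

/-- `ε` is a sign. -/
def IsSign (ε : ℝ) : Prop := ε = 1 ∨ ε = -1

lemma IsSign.neg {ε : ℝ} (h : IsSign ε) : IsSign (-ε) := by
  rcases h with rfl | rfl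
  · exact Or.inr rfl
  · exact Or.inl (neg_neg 1)

lemma odet_rot (ε : ℝ) (a b c : Pt) : odet ε a b c = odet ε b c a := by
  unfold odet det2; ring

lemma odet_swap (ε : ℝ) (a b c : Pt) : odet ε a b c = -odet ε b a c := by
  unfold odet det2; ring

lemma odet_swap_right (ε : ℝ) (a b c : Pt) : odet ε a b c = -odet ε a c b := by
  unfold odet det2; ring

lemma odet_neg (ε : ℝ) (a b c : Pt) : odet (-ε) a b c = -odet ε a b c := by
  unfold odet; ring

@[simp] lemma odet_self_left (ε : ℝ) (a b : Pt) : odet ε a a b = 0 := by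
  unfold odet det2; ring

@[simp] lemma odet_self_right (ε : ℝ) (a b : Pt) : odet ε a b b = 0 := by
  unfold odet det2; ring

@[simp] lemma odet_self_outer (ε : ℝ) (a b : Pt) : odet ε a b a = 0 := by
  unfold odet det2; ring

lemma odet_asymm {ε : ℝ} {a b c : Pt} (h : 0 < odet ε a b c) : ¬ 0 < odet ε a c b := by
  rw [odet_swap_right]; linarith

lemma odet_neg_of_pos {ε : ℝ} {a b c : Pt} (h : 0 < odet ε a b c) : odet ε a c b < 0 := by
  rw [odet_swap_right]; linarith

/-- No three points of `S` are collinear, in terms of determinants. -/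
def GenPos (S : Finset Pt) : Prop :=
  ∀ a ∈ S, ∀ b ∈ S, ∀ c ∈ S, a ≠ b → a ≠ c → b ≠ c → det2 a b c ≠ 0

lemma GenPos.mono {S T : Finset Pt} (h : GenPos S) (hT : T ⊆ S) : GenPos T :=
  fun a ha b hb c hc => h a (hT ha) b (hT hb) c (hT hc)

lemma GenPos.odet_ne {S : Finset Pt} (h : GenPos S) {ε : ℝ} (hε : IsSign ε) {a b c : Pt}
    (ha : a ∈ S) (hb : b ∈ S) (hc : c ∈ S) (hab : a ≠ b) (hac : a ≠ c) (hbc : b ≠ c) :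
    odet ε a b c ≠ 0 := by
  have := h a ha b hb c hc hab hac hbc
  unfold odet
  rcases hε with rfl | rfl <;> simpa using this

/-- `p ∈ S` lies in the interior of no triangle spanned by `S`. -/
def Extreme (S : Finset Pt) (p : Pt) : Prop :=
  p ∈ S ∧ ∀ a ∈ S, ∀ b ∈ S, ∀ c ∈ S,
    ¬ (0 < det2 p a b ∧ 0 < det2 p b c ∧ 0 < det2 p c a)

lemma Extreme.mono {S T : Finset Pt} {p : Pt} (h : Extreme S p) (hT : T ⊆ S) (hp : p ∈ T) :
    Extreme T p :=
  ⟨hp, fun a ha b hb c hc => h.2 a (hT ha) b (hT hb) c (hT hc)⟩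

lemma Extreme.not_odet {S : Finset Pt} {p : Pt} (h : Extreme S p) {ε : ℝ} (hε : IsSign ε)
    {a b c : Pt} (ha : a ∈ S) (hb : b ∈ S) (hc : c ∈ S)
    (h1 : 0 < odet ε p a b) (h2 : 0 < odet ε p b c) (h3 : 0 < odet ε p c a) : False := by
  rcases hε with rfl | rfl
  · exact h.2 a ha b hb c hc ⟨by simpa [odet] using h1, by simpa [odet] using h2,
      by simpa [odet] using h3⟩
  · refine h.2 a ha c hc b hb ⟨?_, ?_, ?_⟩
    · unfold odet det2 at h3; unfold det2; linarith
    · unfold odet det2 at h2; unfold det2; linarith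
    · unfold odet det2 at h1; unfold det2; linarith

lemma Extreme.odet_trans {S : Finset Pt} (hG : GenPos S) {p : Pt} (h : Extreme S p) {ε : ℝ}
    (hε : IsSign ε) {a b c : Pt} (ha : a ∈ S) (hb : b ∈ S) (hc : c ∈ S)
    (h1 : 0 < odet ε p a b) (h2 : 0 < odet ε p b c) : 0 < odet ε p a c := by
  have hpa : p ≠ a := by rintro rfl; simp at h1
  have hpc : p ≠ c := by rintro rfl; simp at h2
  have hac : a ≠ c := by rintro rfl; exact odet_asymm h1 h2
  rcases lt_trichotomy (odet ε p a c) 0 with h3 | h3 | h3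
  · exact (h.not_odet hε ha hb hc h1 h2 (by rw [odet_swap_right]; linarith)).elim
  · exact (hG.odet_ne hε h.1 ha hc hpa hpc hac h3).elim
  · exact h3

/-- Points that are angularly sorted around `p` turn consistently at an extreme middle point. -/
lemma Extreme.odet_of_sorted {S : Finset Pt} (hG : GenPos S) {b : Pt} (h : Extreme S b) {ε : ℝ}
    (hε : IsSign ε) {p a c : Pt} (hp : p ∈ S) (ha : a ∈ S) (hc : c ∈ S)
    (h1 : 0 < odet ε p a b) (h2 : 0 < odet ε p b c) : 0 < odet ε a b c := by
  have hab : a ≠ b := by rintro rfl; simp at h1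
  have hbc : b ≠ c := by rintro rfl; simp at h2
  have hac : a ≠ c := by rintro rfl; exact odet_asymm h1 h2
  rcases lt_trichotomy (odet ε a b c) 0 with h3 | h3 | h3
  · refine (h.not_odet hε hp ha hc ?_ ?_ ?_).elim
    · rw [odet_rot]; exact h1
    · rw [odet_swap]; linarith
    · rw [← odet_rot]; exact h2
  · exact (hG.odet_ne hε ha h.1 hc hab hac hbc h3).elim
  · exact h3

/-- A point on a supporting line that contains at most one further point is extreme. -/
lemma extreme_of_support {S : Finset Pt} {w : Pt} (hw : w ∈ S) {ε : ℝ}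
    {u v x₀ : Pt} (h0 : odet ε u v w = 0) (h : ∀ t ∈ S, t ≠ w → t ≠ x₀ → 0 < odet ε u v t)
    (hx : 0 ≤ odet ε u v x₀) : Extreme S w := by
  refine ⟨hw, ?_⟩
  rintro a ha b hb c hc ⟨h1, h2, h3⟩
  have key : det2 w b c * odet ε u v a + det2 w c a * odet ε u v b + det2 w a b * odet ε u v c
      = (det2 w b c + det2 w c a + det2 w a b) * odet ε u v w := by
    unfold odet det2; ring
  rw [h0, mul_zero] at key
  have haw : a ≠ w := by rintro rfl; simp [det2] at h1
  have hbw : b ≠ w := by rintro rfl; simp [det2] at h1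
  have hcw : c ≠ w := by rintro rfl; simp [det2] at h2
  have hab : a ≠ b := by rintro rfl; unfold det2 at h1; linarith
  have nn : ∀ t ∈ S, t ≠ w → 0 ≤ odet ε u v t := by
    intro t ht htw
    by_cases htx : t = x₀
    · rw [htx]; exact hx
    · exact (h t ht htw htx).le
  have ga := mul_nonneg h2.le (nn a ha haw)
  have gb := mul_nonneg h3.le (nn b hb hbw)
  have gc := mul_nonneg h1.le (nn c hc hcw)
  by_cases hax : a = x₀
  · have : 0 < odet ε u v b := h b hb hbw (by rintro rfl; exact hab hax)
    have := mul_pos h3 this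
    linarith
  · have := mul_pos h2 (h a ha haw hax)
    linarith

lemma exists_first {α : Type*} (r : α → α → Prop) (F : Finset α) (hne : F.Nonempty)
    (htot : ∀ a ∈ F, ∀ b ∈ F, a ≠ b → r a b ∨ r b a)
    (htr : ∀ a ∈ F, ∀ b ∈ F, ∀ c ∈ F, r a b → r b c → r a c) :
    ∃ y ∈ F, ∀ t ∈ F, t ≠ y → r y t := by
  induction F using Finset.induction_on with
  | empty => simp at hne
  | insert a F ha ih =>
    by_cases hF : F.Nonempty
    · obtain ⟨y, hy, hmin⟩ := ih hF
        (fun b hb c hc => htot b (Finset.mem_insert_of_mem hb) c (Finset.mem_insert_of_mem hc))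
        (fun b hb c hc d hd => htr b (Finset.mem_insert_of_mem hb) c
          (Finset.mem_insert_of_mem hc) d (Finset.mem_insert_of_mem hd))
      have hya : y ≠ a := by rintro rfl; exact ha hy
      have hy' : y ∈ insert a F := Finset.mem_insert_of_mem hy
      rcases htot y hy' a (Finset.mem_insert_self _ _) hya with h | h
      · refine ⟨y, hy', fun t ht hty => ?_⟩
        rcases Finset.mem_insert.1 ht with rfl | ht
        · exact h
        · exact hmin t ht hty
      · refine ⟨a, Finset.mem_insert_self _ _, fun t ht hta => ?_⟩
        have ht' := (Finset.mem_insert.1 ht).resolve_left hta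
        by_cases hty : t = y
        · rw [hty]; exact h
        · exact htr a (Finset.mem_insert_self _ _) y hy' t ht h (hmin t ht' hty)
    · rw [Finset.not_nonempty_iff_eq_empty] at hF
      subst hF
      exact ⟨a, by simp, by simp⟩

/-- The angularly first point of a set around an extreme point. -/
lemma Extreme.exists_first_around {S : Finset Pt} (hG : GenPos S) {p : Pt} (h : Extreme S p)
    {ε : ℝ} (hε : IsSign ε) {F : Finset Pt} (hF : F ⊆ S.erase p) (hne : F.Nonempty) :
    ∃ y ∈ F, ∀ t ∈ F, t ≠ y → 0 < odet ε p y t := by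
  have hmem : ∀ a ∈ F, a ≠ p ∧ a ∈ S := fun a ha => Finset.mem_erase.1 (hF ha)
  refine exists_first (fun a b => 0 < odet ε p a b) F hne ?_ ?_
  · intro a ha b hb hab
    have := hG.odet_ne hε h.1 (hmem a ha).2 (hmem b hb).2 (hmem a ha).1.symm (hmem b hb).1.symm hab
    rcases lt_or_gt_of_ne this with h' | h'
    · right; rw [odet_swap_right]; linarith
    · exact Or.inl h'
  · intro a ha b hb c hc
    exact h.odet_trans hG hε (hmem a ha).2 (hmem b hb).2 (hmem c hc).2

/-- The hull neighbour of `p` in `S` on the side given by `ε`. -/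
lemma Extreme.exists_neighbor {S : Finset Pt} (hG : GenPos S) {p : Pt} (h : Extreme S p)
    {ε : ℝ} (hε : IsSign ε) {q : Pt} (hq : q ∈ S) (hqp : q ≠ p) :
    ∃ y ∈ S, y ≠ p ∧ ∀ t ∈ S, t ≠ p → t ≠ y → 0 < odet ε p y t := by
  obtain ⟨y, hy, hmin⟩ := h.exists_first_around hG hε (F := S.erase p) (fun _ => id)
    ⟨q, Finset.mem_erase.2 ⟨hqp, hq⟩⟩
  have hy' := Finset.mem_erase.1 hy
  exact ⟨y, hy'.2, hy'.1, fun t ht htp hty => hmin t (Finset.mem_erase.2 ⟨htp, ht⟩) hty⟩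

/-- A discrete intermediate value argument: a terminal angular segment whose total colour has
the sign opposite to that of `p` contains a point `x` of the other colour such that the points
beyond `x` are balanced. -/
lemma exists_cut {S : Finset Pt} (hG : GenPos S) {σ : Pt → ℤ} (hσ : ∀ t, σ t = 1 ∨ σ t = -1)
    {p : Pt} (hp : Extreme S p) {ε : ℝ} (hε : IsSign ε) (F : Finset Pt) (hF : F ⊆ S.erase p)
    (hcl : ∀ t ∈ F, ∀ t' ∈ S, 0 < odet ε p t t' → t' ∈ F) (hneg : σ p * ∑ t ∈ F, σ t < 0) :
    ∃ x ∈ F, σ x ≠ σ p ∧ ∑ t ∈ S.filter (fun t => 0 < odet ε p x t), σ t = 0 := by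
  induction F using Finset.strongInduction with
  | H F ih =>
    have hne : F.Nonempty := by
      rw [Finset.nonempty_iff_ne_empty]; rintro rfl; simp at hneg
    obtain ⟨y, hy, hmin⟩ := hp.exists_first_around hG hε hF hne
    have hH : S.filter (fun t => 0 < odet ε p y t) = F.erase y := by
      ext t
      simp only [Finset.mem_filter, Finset.mem_erase]
      constructor
      · rintro ⟨ht, h⟩
        exact ⟨by rintro rfl; simp at h, hcl y hy t ht h⟩
      · rintro ⟨h1, h2⟩
        exact ⟨(Finset.mem_erase.1 (hF h2)).2, hmin t h2 h1⟩
    by_cases hcase : σ p * ∑ t ∈ F.erase y, σ t < 0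
    · obtain ⟨x, hx, h1, h2⟩ := ih (F.erase y) (Finset.erase_ssubset hy)
        ((Finset.erase_subset _ _).trans hF) (by
          intro t ht t' ht' h
          have ht2 := Finset.mem_erase.1 ht
          refine Finset.mem_erase.2 ⟨?_, hcl t ht2.2 t' ht' h⟩
          rintro rfl
          exact odet_asymm h (hmin t ht2.2 ht2.1)) hcase
      exact ⟨x, Finset.mem_of_mem_erase hx, h1, h2⟩
    · have hs := Finset.add_sum_erase F σ hy
      refine ⟨y, hy, ?_, ?_⟩
      · intro h
        rw [← hs, h] at hneg
        rcases hσ p with h' | h' <;> rw [h'] at hneg hcase <;> omega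
      · rw [hH]
        rw [← hs] at hneg
        rcases hσ p with h' | h' <;> rcases hσ y with h'' | h'' <;>
          rw [h'] at hneg hcase <;> rw [h''] at hneg <;> omega

/-- Rotating a line that separates `A` from `O` around its point `w ∈ A`: either it first meets
another point of `A`, or it first meets a point of `O`. -/
lemma exists_next_event {S : Finset Pt} (hG : GenPos S) {ε : ℝ} (hε : IsSign ε)
    {A O : Finset Pt} (hA : A ⊆ S) (hO : O ⊆ S) (hOne : O.Nonempty) {w₀ w : Pt} (hw₀ : w₀ ∈ A)
    (hw : w ∈ A) (hApos : ∀ t ∈ A, t ≠ w₀ → t ≠ w → 0 < odet ε w₀ w t)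
    (hOneg : ∀ o ∈ O, odet ε w₀ w o < 0) :
    (∃ e ∈ A, e ≠ w ∧ (∀ t ∈ A, t ≠ w → t ≠ e → 0 < odet ε w e t) ∧
      ∀ o ∈ O, odet ε w e o < 0) ∨
    ∃ o ∈ O, (∀ t ∈ A, t ≠ w → 0 < odet ε o w t) ∧ ∀ o' ∈ O, o' ≠ o → odet ε o w o' < 0 := by
  set ρ : Pt → Pt := fun o => (2 * w.1 - o.1, 2 * w.2 - o.2) with hρ
  have r3 : ∀ a b o, odet ε w a (ρ o) = -odet ε w a o ∧ odet ε a w (ρ o) = - odet ε a w o ∧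
      odet ε w (ρ o) b = -odet ε w o b := by
    intro a b o; simp only [hρ]; unfold odet det2; refine ⟨?_, ?_, ?_⟩ <;> ring
  set K : Finset Pt := (A.erase w₀).erase w ∪ O.image ρ with hK
  have hAO : ∀ o ∈ O, o ∉ A := by
    intro o ho ha
    have h1 := hOneg o ho
    by_cases h2 : o = w₀
    · subst h2; simp at h1
    by_cases h3 : o = w
    · subst h3; simp at h1
    linarith [hApos o ha h2 h3]
  have hwO : ∀ o ∈ O, o ≠ w := by rintro o ho rfl; exact hAO _ ho hw
  have hpos : ∀ k ∈ K, 0 < odet ε w₀ w k := by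
    intro k hk
    rcases Finset.mem_union.1 hk with h | h
    · have h1 := Finset.mem_erase.1 h
      have h2 := Finset.mem_erase.1 h1.2
      exact hApos k h2.2 h2.1 h1.1
    · obtain ⟨o, ho, rfl⟩ := Finset.mem_image.1 h
      rw [(r3 w₀ w o).2.1]; linarith [hOneg o ho]
  have hfirst : ∃ y ∈ K, ∀ t ∈ K, t ≠ y → 0 < odet ε w y t := by
    refine exists_first (fun a b => 0 < odet ε w a b) K ?_ ?_ ?_
    · obtain ⟨o, ho⟩ := hOne
      exact ⟨ρ o, Finset.mem_union_right _ (Finset.mem_image_of_mem _ ho)⟩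
    · have base : ∀ a ∈ S, ∀ b ∈ S, a ≠ w → b ≠ w → a ≠ b → odet ε w a b ≠ 0 := by
        intro a ha b hb h1 h2 h3
        exact hG.odet_ne hε (hA hw) ha hb h1.symm h2.symm h3
      have hne : ∀ a ∈ K, ∀ b ∈ K, a ≠ b → odet ε w a b ≠ 0 := by
        intro a ha b hb hab
        rcases Finset.mem_union.1 ha with ha | ha <;> rcases Finset.mem_union.1 hb with hb | hb
        · have h1 := Finset.mem_erase.1 ha
          have h2 := Finset.mem_erase.1 h1.2
          have h3 := Finset.mem_erase.1 hb
          have h4 := Finset.mem_erase.1 h3.2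
          exact base a (hA h2.2) b (hA h4.2) h1.1 h3.1 hab
        · have h1 := Finset.mem_erase.1 ha
          have h2 := Finset.mem_erase.1 h1.2
          obtain ⟨o, ho, rfl⟩ := Finset.mem_image.1 hb
          rw [(r3 a w o).1]
          exact neg_ne_zero.2 (base a (hA h2.2) o (hO ho) h1.1 (hwO o ho)
            (by rintro rfl; exact hAO _ ho h2.2))
        · have h1 := Finset.mem_erase.1 hb
          have h2 := Finset.mem_erase.1 h1.2
          obtain ⟨o, ho, rfl⟩ := Finset.mem_image.1 ha
          rw [(r3 w b o).2.2]
          exact neg_ne_zero.2 (base o (hO ho) b (hA h2.2) (hwO o ho) h1.1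
            (by rintro rfl; exact hAO _ ho h2.2))
        · obtain ⟨o, ho, rfl⟩ := Finset.mem_image.1 ha
          obtain ⟨o', ho', rfl⟩ := Finset.mem_image.1 hb
          rw [(r3 _ w o').1, (r3 w _ o).2.2, neg_neg]
          exact base o (hO ho) o' (hO ho') (hwO o ho) (hwO o' ho') (by rintro rfl; exact hab rfl)
      intro a ha b hb hab
      rcases lt_or_gt_of_ne (hne a ha b hb hab) with h | h
      · right; rw [odet_swap_right]; linarith
      · exact Or.inl h
    · intro a ha b hb c hc h1 h2
      have key : odet ε w₀ w b * odet ε w a c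
          = odet ε w₀ w a * odet ε w b c + odet ε w₀ w c * odet ε w a b := by
        unfold odet det2; ring
      have := add_pos (mul_pos (hpos a ha) h2) (mul_pos (hpos c hc) h1)
      rw [← key] at this
      exact (pos_iff_pos_of_mul_pos this).1 (hpos b hb)
  obtain ⟨y, hy, hmin⟩ := hfirst
  have hA' : ∀ t ∈ A, t ≠ w₀ → t ≠ w → t ∈ K := fun t ht h1 h2 =>
    Finset.mem_union_left _ (Finset.mem_erase.2 ⟨h2, Finset.mem_erase.2 ⟨h1, ht⟩⟩)
  have hO' : ∀ o ∈ O, ρ o ∈ K := fun o ho =>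
    Finset.mem_union_right _ (Finset.mem_image_of_mem _ ho)
  have hρinj : ∀ o o', ρ o = ρ o' → o = o' := by
    intro o o' h
    simp only [hρ, Prod.mk.injEq] at h
    exact Prod.ext (by linarith [h.1]) (by linarith [h.2])
  by_cases hyA : y ∈ (A.erase w₀).erase w
  · left
    have h1 := Finset.mem_erase.1 hyA
    have h2 := Finset.mem_erase.1 h1.2
    refine ⟨y, h2.2, h1.1, ?_, ?_⟩
    · intro t ht htw hty
      by_cases ht0 : t = w₀
      · rw [ht0, ← odet_rot]; exact hpos y hy
      · exact hmin t (hA' t ht ht0 htw) hty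
    · intro o ho
      have hne : ρ o ≠ y := by
        intro h
        -- `y` would be the reflection of `o`, so `w`, `o`, `y` would be collinear
        have h3 : odet ε w y o = 0 := by rw [← h]; simp only [hρ]; unfold odet det2; ring
        exact hG.odet_ne hε (hA hw) (hA h2.2) (hO ho) h1.1.symm (hwO o ho).symm
          (by rintro rfl; exact hAO _ ho h2.2) h3
      have := hmin _ (hO' o ho) hne
      rw [(r3 y w o).1] at this; linarith
  · right
    obtain ⟨o, ho, rfl⟩ := Finset.mem_image.1 ((Finset.mem_union.1 hy).resolve_left hyA)
    refine ⟨o, ho, ?_, ?_⟩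
    · intro t ht htw
      by_cases ht0 : t = w₀
      · have := hOneg o ho
        rw [ht0]
        unfold odet det2 at *
        linarith
      · have hne : t ≠ ρ o := by
          intro h
          have h3 : odet ε w t o = 0 := by rw [h]; simp only [hρ]; unfold odet det2; ring
          exact hG.odet_ne hε (hA hw) (hA ht) (hO ho) (Ne.symm htw) (hwO o ho).symm
            (by rintro rfl; exact hAO _ ho ht) h3
        have := hmin t (hA' t ht ht0 htw) hne
        rw [(r3 w t o).2.2] at this
        rw [odet_swap]; exact this
    · intro o' ho' hne
      have := hmin _ (hO' o' ho') (fun h => hne (hρinj _ _ h))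
      rw [(r3 _ w o').1, (r3 w _ o).2.2, neg_neg] at this
      rw [odet_swap]; linarith

/-! ### Crossings in finite sets of edges -/

lemma segCross_comm {e f : Pt × Pt} (h : SegCross e f) : SegCross f e := by
  obtain ⟨x, h1, h2⟩ := h
  exact ⟨x, h2, h1⟩

lemma segCross_self (e : Pt × Pt) : SegCross e e := by
  have : (openSegment ℝ e.1 e.2).Nonempty :=
    ⟨_, (1 / 2 : ℝ), (1 / 2 : ℝ), by norm_num, by norm_num, by norm_num, rfl⟩
  obtain ⟨x, hx⟩ := this
  exact ⟨x, hx, hx⟩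

lemma segCross_swap (e f : Pt × Pt) : SegCross e.swap f.swap ↔ SegCross e f := by
  simp only [SegCross, Prod.fst_swap, Prod.snd_swap, openSegment_symm ℝ e.2 e.1,
    openSegment_symm ℝ f.2 f.1]

/-- The number of edges of `E` crossing `e`. -/
def edgeDeg (E : Finset (Pt × Pt)) (e : Pt × Pt) : ℕ :=
  (E.filter fun f => f ≠ e ∧ SegCross e f).card

/-- Every edge of `E` is crossed at most once. -/
def OnePlaneSet (E : Finset (Pt × Pt)) : Prop := ∀ e ∈ E, edgeDeg E e ≤ 1

/-- The number of uncrossed edges of `E`. -/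
def uncrossed (E : Finset (Pt × Pt)) : ℕ := (E.filter fun e => edgeDeg E e = 0).card

/-- No edge of `E` crosses an edge of `F`. -/
def NoCross (E F : Finset (Pt × Pt)) : Prop := ∀ e ∈ E, ∀ f ∈ F, ¬ SegCross e f

lemma NoCross.symm {E F : Finset (Pt × Pt)} (h : NoCross E F) : NoCross F E :=
  fun f hf e he hc => h e he f hf (segCross_comm hc)

lemma NoCross.disjoint {E F : Finset (Pt × Pt)} (h : NoCross E F) : Disjoint E F :=
  Finset.disjoint_left.2 fun e he hf => h e he e hf (segCross_self e)

lemma NoCross.edgeDeg_union {E F : Finset (Pt × Pt)} (h : NoCross E F) {e : Pt × Pt}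
    (he : e ∈ E) : edgeDeg (E ∪ F) e = edgeDeg E e := by
  unfold edgeDeg
  congr 1
  ext f
  simp only [Finset.mem_filter, Finset.mem_union]
  constructor
  · rintro ⟨hf | hf, h1, h2⟩
    · exact ⟨hf, h1, h2⟩
    · exact (h e he f hf h2).elim
  · rintro ⟨hf, h1⟩
    exact ⟨Or.inl hf, h1⟩

lemma NoCross.onePlaneSet_union {E F : Finset (Pt × Pt)} (h : NoCross E F)
    (hE : OnePlaneSet E) (hF : OnePlaneSet F) : OnePlaneSet (E ∪ F) := by
  intro e he
  rcases Finset.mem_union.1 he with he | he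
  · rw [h.edgeDeg_union he]; exact hE e he
  · rw [Finset.union_comm, h.symm.edgeDeg_union he]; exact hF e he

lemma NoCross.uncrossed_union {E F : Finset (Pt × Pt)} (h : NoCross E F) :
    uncrossed (E ∪ F) = uncrossed E + uncrossed F := by
  unfold uncrossed
  rw [Finset.filter_union, Finset.card_union_of_disjoint
    (Finset.disjoint_filter_filter h.disjoint)]
  congr 2
  · exact Finset.filter_congr fun e he => by rw [h.edgeDeg_union he]
  · exact Finset.filter_congr fun e he => by
      rw [Finset.union_comm, h.symm.edgeDeg_union he]

lemma edgeDeg_image_swap (E : Finset (Pt × Pt)) (e : Pt × Pt) :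
    edgeDeg (E.image Prod.swap) e.swap = edgeDeg E e := by
  unfold edgeDeg
  rw [Finset.filter_image, Finset.card_image_of_injective _ Prod.swap_injective]
  congr 1
  exact Finset.filter_congr fun f _ => by
    rw [segCross_swap, Ne, Prod.swap_injective.eq_iff]

lemma onePlaneSet_image_swap {E : Finset (Pt × Pt)} (h : OnePlaneSet E) :
    OnePlaneSet (E.image Prod.swap) := by
  intro e he
  obtain ⟨f, hf, rfl⟩ := Finset.mem_image.1 he
  rw [edgeDeg_image_swap]
  exact h f hf

lemma uncrossed_image_swap (E : Finset (Pt × Pt)) :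
    uncrossed (E.image Prod.swap) = uncrossed E := by
  unfold uncrossed
  rw [Finset.filter_image, Finset.card_image_of_injective _ Prod.swap_injective]
  congr 1
  exact Finset.filter_congr fun f _ => by rw [edgeDeg_image_swap]

lemma onePlaneSet_pair (e f : Pt × Pt) : OnePlaneSet {e, f} := by
  intro g hg
  refine (Finset.card_le_card (t := ({e, f} : Finset (Pt × Pt)).erase g) ?_).trans ?_
  · intro h hh
    have := Finset.mem_filter.1 hh
    exact Finset.mem_erase.2 ⟨this.2.1, this.1⟩
  · rw [Finset.card_erase_of_mem hg]
    have := Finset.card_le_two (a := e) (b := f)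
    omega

lemma uncrossed_singleton (e : Pt × Pt) : uncrossed {e} = 1 := by
  have : edgeDeg {e} e = 0 := by
    unfold edgeDeg
    rw [Finset.card_eq_zero, Finset.filter_eq_empty_iff]
    intro f hf h
    exact h.1 (Finset.mem_singleton.1 hf)
  unfold uncrossed
  rw [Finset.filter_singleton, if_pos this, Finset.card_singleton]

/-! ### Edges of paths -/

lemma pathEdges_append (l₁ l₂ : List Pt) (w : Pt) :
    pathEdges (l₁ ++ w :: l₂) = pathEdges (l₁ ++ [w]) ++ pathEdges (w :: l₂) := by
  induction l₁ with
  | nil => simp [pathEdges]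
  | cons a l ih =>
    cases l with
    | nil => simp [pathEdges]
    | cons b l =>
      have h : ∀ m : List Pt, pathEdges (a :: b :: m) = (a, b) :: pathEdges (b :: m) :=
        fun m => rfl
      simp only [List.cons_append] at ih ⊢
      rw [h, h, ih, List.cons_append]

lemma pathEdges_reverse (l : List Pt) :
    pathEdges l.reverse = ((pathEdges l).map Prod.swap).reverse := by
  induction l with
  | nil => rfl
  | cons a l ih =>
    cases l with
    | nil => rfl
    | cons b l =>
      have h : pathEdges (a :: b :: l) = (a, b) :: pathEdges (b :: l) := rfl
      rw [h, List.map_cons, List.reverse_cons, List.reverse_cons (as := List.map _ _), ← ih,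
        List.reverse_cons, List.append_assoc, List.singleton_append, pathEdges_append]
      rfl

lemma mem_of_mem_pathEdges {l : List Pt} {e : Pt × Pt} (h : e ∈ pathEdges l) :
    e.1 ∈ l ∧ e.2 ∈ l := by
  have := List.of_mem_zip h
  exact ⟨this.1, List.mem_of_mem_tail this.2⟩

lemma ne_of_mem_pathEdges {l : List Pt} (hl : l.Nodup) {e : Pt × Pt} (h : e ∈ pathEdges l) :
    e.1 ≠ e.2 := by
  induction l with
  | nil => simp [pathEdges] at h
  | cons a l ih =>
    cases l with
    | nil => simp [pathEdges] at h
    | cons b l =>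
      rcases List.mem_cons.1 (show e ∈ (a, b) :: pathEdges (b :: l) from h) with rfl | h
      · rintro (rfl : a = b)
        simp at hl
      · exact ih hl.of_cons h

/-- `S` carries a properly coloured Hamiltonian 1-plane path from `p` to `q` with at least `m`
uncrossed edges. -/
def HasPath (σ : Pt → ℤ) (S : Finset Pt) (p q : Pt) (m : ℕ) : Prop :=
  ∃ l : List Pt, (p :: (l ++ [q])).Nodup ∧ (p :: (l ++ [q])).toFinset = S ∧
    (∀ e ∈ pathEdges (p :: (l ++ [q])), σ e.1 ≠ σ e.2) ∧
    OnePlaneSet (pathEdges (p :: (l ++ [q]))).toFinset ∧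
    m ≤ uncrossed (pathEdges (p :: (l ++ [q]))).toFinset

/-- No segment spanned by `X` crosses a segment spanned by `Y`. -/
def NoCrossPts (X Y : Finset Pt) : Prop :=
  ∀ a ∈ X, ∀ b ∈ X, ∀ c ∈ Y, ∀ d ∈ Y, a ≠ b → c ≠ d → ¬ SegCross (a, b) (c, d)

/-- The edge `(a, b)` crosses no segment spanned by `Y`. -/
def NoCrossEdge (a b : Pt) (Y : Finset Pt) : Prop :=
  ∀ c ∈ Y, ∀ d ∈ Y, c ≠ d → ¬ SegCross (a, b) (c, d)

lemma HasPath.mono {σ : Pt → ℤ} {S : Finset Pt} {p q : Pt} {m m' : ℕ} (h : HasPath σ S p q m)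
    (hm : m' ≤ m) : HasPath σ S p q m' := by
  obtain ⟨l, h1, h2, h3, h4, h5⟩ := h
  exact ⟨l, h1, h2, h3, h4, hm.trans h5⟩

lemma HasPath.symm {σ : Pt → ℤ} {S : Finset Pt} {p q : Pt} {m : ℕ} (h : HasPath σ S p q m) :
    HasPath σ S q p m := by
  obtain ⟨l, h1, h2, h3, h4, h5⟩ := h
  have hr : q :: (l.reverse ++ [p]) = (p :: (l ++ [q])).reverse := by simp
  have hE : (pathEdges (p :: (l ++ [q])).reverse).toFinset
      = (pathEdges (p :: (l ++ [q]))).toFinset.image Prod.swap := by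
    rw [pathEdges_reverse]
    ext e
    simp only [List.mem_toFinset, List.mem_reverse, List.mem_map, Finset.mem_image]
  refine ⟨l.reverse, ?_, ?_, ?_, ?_, ?_⟩
  · rw [hr]; exact List.nodup_reverse.2 h1
  · rw [hr, List.toFinset_reverse]; exact h2
  · rw [hr, pathEdges_reverse]
    intro e he
    obtain ⟨f, hf, rfl⟩ := List.mem_map.1 (List.mem_reverse.1 he)
    exact (h3 f hf).symm
  · rw [hr, hE]; exact onePlaneSet_image_swap h4
  · rw [hr, hE, uncrossed_image_swap]; exact h5

lemma hasPath_pair {σ : Pt → ℤ} {p q : Pt} (hpq : σ p ≠ σ q) : HasPath σ {p, q} p q 1 := by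
  have hne : p ≠ q := by rintro rfl; exact hpq rfl
  have hE : pathEdges [p, q] = [(p, q)] := rfl
  refine ⟨[], by simpa using hne, by ext; simp, ?_, ?_, ?_⟩
  · simpa [hE] using hpq
  · rw [List.nil_append, hE]
    simpa using onePlaneSet_pair (p, q) (p, q)
  · rw [List.nil_append, hE]
    simpa using (uncrossed_singleton (p, q)).ge

lemma HasPath.glue {σ : Pt → ℤ} {X Y : Finset Pt} {p q w : Pt} {m₁ m₂ : ℕ}
    (h₁ : HasPath σ X p w m₁) (h₂ : HasPath σ Y w q m₂) (hXY : ∀ t ∈ X, t ∈ Y → t = w)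
    (hNC : NoCrossPts X Y) : HasPath σ (X ∪ Y) p q (m₁ + m₂) := by
  obtain ⟨l₁, a1, a2, a3, a4, a5⟩ := h₁
  obtain ⟨l₂, b1, b2, b3, b4, b5⟩ := h₂
  have hV : p :: ((l₁ ++ w :: l₂) ++ [q]) = (p :: l₁) ++ w :: (l₂ ++ [q]) := by simp
  have hE : pathEdges ((p :: l₁) ++ w :: (l₂ ++ [q]))
      = pathEdges (p :: (l₁ ++ [w])) ++ pathEdges (w :: (l₂ ++ [q])) := by
    rw [pathEdges_append]; rfl
  have hN : NoCross (pathEdges (p :: (l₁ ++ [w]))).toFinset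
      (pathEdges (w :: (l₂ ++ [q]))).toFinset := by
    intro e he f hf
    rw [List.mem_toFinset] at he hf
    have he' := mem_of_mem_pathEdges he
    have hf' := mem_of_mem_pathEdges hf
    rw [← List.mem_toFinset, a2, ← List.mem_toFinset, a2] at he'
    rw [← List.mem_toFinset, b2, ← List.mem_toFinset, b2] at hf'
    exact hNC _ he'.1 _ he'.2 _ hf'.1 _ hf'.2 (ne_of_mem_pathEdges a1 he)
      (ne_of_mem_pathEdges b1 hf)
  refine ⟨l₁ ++ w :: l₂, ?_, ?_, ?_, ?_, ?_⟩
  · rw [hV, List.nodup_append']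
    have a1' : ((p :: l₁) ++ [w]).Nodup := a1
    rw [List.nodup_append'] at a1'
    refine ⟨a1'.1, b1, fun t ht ht' => ?_⟩
    have hX : t ∈ X := by
      rw [← a2, List.mem_toFinset]
      exact List.mem_append_left [w] ht
    have hY : t ∈ Y := by rw [← b2, List.mem_toFinset]; exact ht'
    exact a1'.2.2 ht (by rw [hXY t hX hY]; simp)
  · rw [← a2, ← b2]
    ext t
    simp only [List.mem_toFinset, Finset.mem_union, List.mem_cons, List.mem_append]
    tauto
  · rw [hV, hE]
    intro e he
    rcases List.mem_append.1 he with he | he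
    · exact a3 e he
    · exact b3 e he
  · rw [hV, hE, List.toFinset_append]
    exact hN.onePlaneSet_union a4 b4
  · rw [hV, hE, List.toFinset_append, hN.uncrossed_union]
    exact Nat.add_le_add a5 b5

lemma HasPath.cons {σ : Pt → ℤ} {Y : Finset Pt} {p q z : Pt} {m : ℕ}
    (h : HasPath σ Y z q m) (hp : p ∉ Y) (hpz : σ p ≠ σ z) (hNC : NoCrossEdge p z Y) :
    HasPath σ (insert p Y) p q (m + 1) := by
  have hz : z ∈ Y := by
    obtain ⟨l, -, h2, -⟩ := h
    rw [← h2]; simp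
  have h1 := (hasPath_pair hpz).glue h (by
    intro t ht ht'
    rcases Finset.mem_insert.1 ht with rfl | ht
    · exact (hp ht').elim
    · exact Finset.mem_singleton.1 ht) (by
    intro a ha b hb c hc d hd hab hcd
    rcases Finset.mem_insert.1 ha with rfl | ha' <;> rcases Finset.mem_insert.1 hb with rfl | hb'
    · exact (hab rfl).elim
    · rw [Finset.mem_singleton.1 hb']; exact hNC c hc d hd hcd
    · rw [Finset.mem_singleton.1 ha']
      intro hx
      have := (segCross_swap _ _).2 hx
      exact hNC d hd c hc hcd.symm this
    · exact (hab ((Finset.mem_singleton.1 ha').trans (Finset.mem_singleton.1 hb').symm)).elim)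
  have hS : ({p, z} : Finset Pt) ∪ Y = insert p Y := by
    ext t
    simp only [Finset.mem_union, Finset.mem_insert, Finset.mem_singleton]
    constructor
    · rintro ((rfl | rfl) | h)
      · exact Or.inl rfl
      · exact Or.inr hz
      · exact Or.inr h
    · rintro (rfl | h)
      · exact Or.inl (Or.inl rfl)
      · exact Or.inr h
  rw [hS, add_comm] at h1
  exact h1

lemma HasPath.peel {σ : Pt → ℤ} {Y : Finset Pt} {p q c d : Pt} {m : ℕ}
    (h : HasPath σ Y c d m) (hp : p ∉ Y) (hq : q ∉ Y) (hpq : p ≠ q) (hpc : σ p ≠ σ c)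
    (hdq : σ d ≠ σ q) (hNp : NoCrossEdge p c Y) (hNq : NoCrossEdge d q Y) :
    HasPath σ (insert p (insert q Y)) p q m := by
  obtain ⟨l, h1, h2, h3, h4, h5⟩ := h
  have hE : pathEdges (p :: ((c :: (l ++ [d])) ++ [q]))
      = (p, c) :: (pathEdges (c :: (l ++ [d])) ++ [(d, q)]) := by
    have : p :: ((c :: (l ++ [d])) ++ [q]) = p :: ((c :: l) ++ d :: [q]) := by simp
    rw [this]
    change (p, c) :: pathEdges ((c :: l) ++ d :: [q]) = _
    rw [pathEdges_append]
    rfl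
  have hF : ((p, c) :: (pathEdges (c :: (l ++ [d])) ++ [(d, q)])).toFinset
      = (pathEdges (c :: (l ++ [d]))).toFinset ∪ {(p, c), (d, q)} := by
    ext e
    simp only [List.mem_toFinset, List.mem_cons, List.mem_append, Finset.mem_union,
      Finset.mem_insert, Finset.mem_singleton, List.not_mem_nil, or_false]
    tauto
  have hN : NoCross (pathEdges (c :: (l ++ [d]))).toFinset {(p, c), (d, q)} := by
    intro e he f hf hx
    rw [List.mem_toFinset] at he
    have he' := mem_of_mem_pathEdges he
    rw [← List.mem_toFinset, h2, ← List.mem_toFinset, h2] at he'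
    have hne := ne_of_mem_pathEdges h1 he
    rcases Finset.mem_insert.1 hf with rfl | hf
    · exact hNp _ he'.1 _ he'.2 hne (segCross_comm hx)
    · rw [Finset.mem_singleton.1 hf] at hx
      exact hNq _ he'.1 _ he'.2 hne (segCross_comm hx)
  have hp' : p ∉ c :: (l ++ [d]) := by rwa [← List.mem_toFinset, h2]
  have hq' : q ∉ c :: (l ++ [d]) := by rwa [← List.mem_toFinset, h2]
  refine ⟨c :: (l ++ [d]), ?_, ?_, ?_, ?_, ?_⟩
  · rw [List.nodup_cons, List.nodup_append']
    refine ⟨?_, h1, by simp, ?_⟩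
    · rw [List.mem_append, not_or]
      exact ⟨hp', by simpa using hpq⟩
    · intro t ht ht'
      rw [List.mem_singleton] at ht'
      exact hq' (ht' ▸ ht)
  · rw [← h2]
    ext t
    simp only [List.mem_toFinset, Finset.mem_insert, List.mem_cons, List.mem_append,
      List.not_mem_nil, or_false]
    tauto
  · rw [hE]
    intro e he
    rcases List.mem_cons.1 he with rfl | he
    · exact hpc
    · rcases List.mem_append.1 he with he | he
      · exact h3 e he
      · rw [List.mem_singleton.1 he]; exact hdq
  · rw [hE, hF]
    exact hN.onePlaneSet_union h4 (onePlaneSet_pair _ _)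
  · rw [hE, hF, hN.uncrossed_union]
    omega

/-! ### Separating lines -/

/-- Two edges on opposite closed sides of a line do not cross if one of them is not contained
in the line. -/
lemma not_segCross_of_odet {ε : ℝ} {u v a b c d : Pt}
    (ha : 0 ≤ odet ε u v a) (hb : 0 ≤ odet ε u v b) (hc : odet ε u v c ≤ 0)
    (hd : odet ε u v d ≤ 0)
    (h : 0 < odet ε u v a ∨ 0 < odet ε u v b ∨ odet ε u v c < 0 ∨ odet ε u v d < 0) :
    ¬ SegCross (a, b) (c, d) := by
  rintro ⟨x, ⟨s, t, hs, ht, hst, h1⟩, ⟨s', t', hs', ht', hst', h2⟩⟩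
  have lin : ∀ (y z : Pt) (s t : ℝ), s + t = 1 →
      odet ε u v (s • y + t • z) = s * odet ε u v y + t * odet ε u v z := by
    intro y z s t hst
    obtain rfl : t = 1 - s := by linarith
    unfold odet det2
    simp only [Prod.fst_add, Prod.snd_add, Prod.smul_fst, Prod.smul_snd, smul_eq_mul]
    ring
  have e1 := lin a b s t hst
  have e2 := lin c d s' t' hst'
  simp only at h1 h2
  rw [h1] at e1
  rw [h2] at e2
  have n1 := mul_nonneg hs.le ha
  have n2 := mul_nonneg ht.le hb
  have n3 := mul_nonneg hs'.le (neg_nonneg.2 hc)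
  have n4 := mul_nonneg ht'.le (neg_nonneg.2 hd)
  rcases h with h | h | h | h
  · have := mul_pos hs h; linarith
  · have := mul_pos ht h; linarith
  · have := mul_pos hs' (neg_pos.2 h); linarith
  · have := mul_pos ht' (neg_pos.2 h); linarith

/-- Point sets on opposite closed sides of a line span non-crossing segments if one of them has
at most one point on the line. -/
lemma noCrossPts_of_odet {ε : ℝ} {u v w : Pt} {X Y : Finset Pt}
    (hX : ∀ t ∈ X, t ≠ w → 0 < odet ε u v t) (hw : odet ε u v w = 0)
    (hY : ∀ t ∈ Y, odet ε u v t ≤ 0) : NoCrossPts X Y := by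
  intro a ha b hb c hc d hd hab _
  have nn : ∀ t ∈ X, 0 ≤ odet ε u v t := by
    intro t ht
    by_cases h : t = w
    · rw [h, hw]
    · exact (hX t ht h).le
  refine not_segCross_of_odet (nn a ha) (nn b hb) (hY c hc) (hY d hd) ?_
  by_cases h : a = w
  · exact Or.inr (Or.inl (hX b hb (by rintro rfl; exact hab h)))
  · exact Or.inl (hX a ha h)

/-- An edge on the closed nonpositive side of a line crosses no segment of a point set on the
positive side. -/
lemma noCrossEdge_of_odet {ε : ℝ} {u v w a b : Pt} {Y : Finset Pt}
    (hY : ∀ t ∈ Y, t ≠ w → 0 < odet ε u v t) (hw : odet ε u v w = 0)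
    (ha : odet ε u v a ≤ 0) (hb : odet ε u v b ≤ 0) : NoCrossEdge a b Y := by
  intro c hc d hd hcd hx
  have nn : ∀ t ∈ Y, 0 ≤ odet ε u v t := by
    intro t ht
    by_cases h : t = w
    · rw [h, hw]
    · exact (hY t ht h).le
  refine not_segCross_of_odet (nn c hc) (nn d hd) ha hb ?_ (segCross_comm hx)
  by_cases h : c = w
  · exact Or.inr (Or.inl (hY d hd (by rintro rfl; exact hcd h)))
  · exact Or.inl (hY c hc h)

lemma noCrossEdge_of_odet_neg {ε : ℝ} {u v a b : Pt} {Y : Finset Pt}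
    (hY : ∀ t ∈ Y, 0 ≤ odet ε u v t) (ha : odet ε u v a < 0) (hb : odet ε u v b ≤ 0) :
    NoCrossEdge a b Y := fun c hc d hd _ hx =>
  not_segCross_of_odet (hY c hc) (hY d hd) ha.le hb (Or.inr (Or.inr (Or.inl ha)))
    (segCross_comm hx)

lemma NoCrossEdge.symm {a b : Pt} {Y : Finset Pt} (h : NoCrossEdge a b Y) :
    NoCrossEdge b a Y := fun c hc d hd hcd hx =>
  h d hd c hc hcd.symm ((segCross_swap _ _).2 hx)

lemma NoCrossPts.symm {X Y : Finset Pt} (h : NoCrossPts X Y) : NoCrossPts Y X :=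
  fun a ha b hb c hc d hd hab hcd hx => h c hc d hd a ha b hb hcd hab (segCross_comm hx)

/-! ### Colour changes along lists -/

/-- The number of colour changes between consecutive points of a list. -/
def changes (σ : Pt → ℤ) : List Pt → ℕ
  | [] => 0
  | [_] => 0
  | a :: b :: l => (if σ a = σ b then 0 else 1) + changes σ (b :: l)

/-- The number of colour changes along a list read cyclically. -/
def cyclicChanges (σ : Pt → ℤ) : List Pt → ℕ
  | [] => 0
  | a :: l => changes σ (a :: (l ++ [a]))

lemma changes_cons_cons (σ : Pt → ℤ) (a b : Pt) (l : List Pt) :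
    changes σ (a :: b :: l) = (if σ a = σ b then 0 else 1) + changes σ (b :: l) := rfl

lemma changes_append (σ : Pt → ℤ) (l₁ l₂ : List Pt) (w : Pt) :
    changes σ (l₁ ++ w :: l₂) = changes σ (l₁ ++ [w]) + changes σ (w :: l₂) := by
  induction l₁ with
  | nil => simp [changes]
  | cons a l ih =>
    cases l with
    | nil => simp [changes]
    | cons b l =>
      simp only [List.cons_append, changes_cons_cons] at ih ⊢
      rw [ih]; omega

lemma changes_cons_le (σ : Pt → ℤ) (a : Pt) (l : List Pt) :
    changes σ l ≤ changes σ (a :: l) := by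
  cases l with
  | nil => exact Nat.zero_le _
  | cons b l => rw [changes_cons_cons]; omega

lemma changes_le_cons_cons (σ : Pt → ℤ) (a b : Pt) (l : List Pt) :
    changes σ (a :: l) ≤ changes σ (a :: b :: l) := by
  cases l with
  | nil => exact Nat.zero_le _
  | cons c l =>
    simp only [changes_cons_cons]
    split_ifs <;> omega

lemma changes_cons_sublist (σ : Pt → ℤ) {l l' : List Pt} (h : l.Sublist l') (a : Pt) :
    changes σ (a :: l) ≤ changes σ (a :: l') := by
  induction h generalizing a with
  | slnil => exact le_rfl
  | cons b _ ih => exact (ih a).trans (changes_le_cons_cons σ a b _)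
  | cons_cons b _ ih =>
    rw [changes_cons_cons, changes_cons_cons]
    exact Nat.add_le_add_left (ih b) _

lemma changes_sublist (σ : Pt → ℤ) {l l' : List Pt} (h : l.Sublist l') :
    changes σ l ≤ changes σ l' := by
  induction h with
  | slnil => exact le_rfl
  | cons b _ ih => exact ih.trans (changes_cons_le σ b _)
  | cons_cons b h _ => exact changes_cons_sublist σ h b

lemma changes_reverse (σ : Pt → ℤ) (l : List Pt) : changes σ l.reverse = changes σ l := by
  induction l with
  | nil => rfl
  | cons a l ih =>
    cases l with
    | nil => rfl
    | cons b l =>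
      rw [List.reverse_cons, List.reverse_cons, List.append_assoc, List.singleton_append,
        changes_append, ← List.reverse_cons, ih, changes_cons_cons]
      simp only [changes, eq_comm]
      omega

lemma cyclicChanges_append_comm (σ : Pt → ℤ) (l₁ l₂ : List Pt) :
    cyclicChanges σ (l₁ ++ l₂) = cyclicChanges σ (l₂ ++ l₁) := by
  cases l₁ with
  | nil => simp
  | cons a l₁ =>
    cases l₂ with
    | nil => simp
    | cons b l₂ =>
      have h1 := changes_append σ (a :: l₁) (l₂ ++ [a]) b
      have h2 := changes_append σ (b :: l₂) (l₁ ++ [b]) a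
      simp only [cyclicChanges, List.cons_append, List.append_assoc] at h1 h2 ⊢
      rw [h1, h2, add_comm]

lemma cyclicChanges_reverse (σ : Pt → ℤ) (l : List Pt) :
    cyclicChanges σ l.reverse = cyclicChanges σ l := by
  cases l with
  | nil => rfl
  | cons a l =>
    rw [List.reverse_cons, cyclicChanges_append_comm]
    change changes σ (a :: (l.reverse ++ [a])) = changes σ (a :: (l ++ [a]))
    rw [← changes_reverse]
    simp

lemma cyclicChanges_sublist (σ : Pt → ℤ) {l l' : List Pt} (h : l.Sublist l') :
    cyclicChanges σ l ≤ cyclicChanges σ l' := by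
  cases l with
  | nil => exact Nat.zero_le _
  | cons a l =>
    obtain ⟨r₁, r₂, rfl, ha, hs⟩ := List.cons_sublist_iff.1 h
    obtain ⟨u, v, rfl⟩ := List.append_of_mem ha
    rw [List.append_assoc, cyclicChanges_append_comm]
    refine changes_sublist σ (List.Sublist.cons_cons a (List.Sublist.append_right ?_ [a]))
    exact hs.trans ((List.sublist_append_right v r₂).trans (List.sublist_append_left _ u))

/-- Replacing the endpoint of a list by a point of equal colour. -/
lemma changes_congr_last (σ : Pt → ℤ) {x y : Pt} (h : σ x = σ y) (l : List Pt) :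
    changes σ (l ++ [x]) = changes σ (l ++ [y]) := by
  induction l with
  | nil => rfl
  | cons a l ih =>
    cases l with
    | nil => simp [changes, h]
    | cons b l =>
      simp only [List.cons_append, changes_cons_cons] at ih ⊢
      rw [ih]

lemma changes_congr_head (σ : Pt → ℤ) {x y : Pt} (h : σ x = σ y) (l : List Pt) :
    changes σ (x :: l) = changes σ (y :: l) := by
  cases l with
  | nil => rfl
  | cons a l => simp [changes_cons_cons, h]

lemma changes_concat_le (σ : Pt → ℤ) (x y : Pt) (l : List Pt) :
    changes σ (l ++ [x]) ≤ changes σ (l ++ [y]) + 1 := by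
  have h1 : changes σ (l ++ [x]) ≤ changes σ (l ++ y :: [x]) :=
    changes_sublist σ (List.Sublist.append_left (List.sublist_cons_self y [x]) l)
  rw [changes_append σ l [x] y] at h1
  have : changes σ [y, x] ≤ 1 := by
    simp only [changes]; split_ifs <;> omega
  omega

/-- Closing up a path between points of different colours costs at most one change. -/
lemma changes_le_cyclicChanges_add_one {σ : Pt → ℤ} (hσ : ∀ t, σ t = 1 ∨ σ t = -1) {x p : Pt}
    (h : σ x ≠ σ p) (l : List Pt) :
    changes σ (x :: (l ++ [p])) ≤ cyclicChanges σ l + 1 := by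
  cases l with
  | nil => simp [changes, h]
  | cons a l =>
    rw [List.cons_append, changes_cons_cons, cyclicChanges]
    by_cases hx : σ x = σ a
    · have := changes_concat_le σ p a (a :: l)
      simp only [List.cons_append] at this
      rw [if_pos hx]; omega
    · have hp : σ p = σ a := by
        rcases hσ x with h1 | h1 <;> rcases hσ p with h2 | h2 <;> rcases hσ a with h3 | h3 <;>
          simp_all
      have := changes_congr_last σ hp (a :: l)
      simp only [List.cons_append] at this
      rw [if_neg hx, this]; omega

lemma sublist_of_pairwise {α : Type*} {r : α → α → Prop} (hr : ∀ a b, r a b → ¬ r b a)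
    {l l' : List α} (hl : l.Pairwise r) (hl' : l'.Pairwise r) (h : ∀ t ∈ l, t ∈ l') :
    l.Sublist l' := by
  induction l' generalizing l with
  | nil =>
    rw [List.eq_nil_iff_forall_not_mem.2 fun t ht => (List.not_mem_nil (h t ht))]
  | cons a m ih =>
    cases l with
    | nil => exact List.nil_sublist _
    | cons b s =>
      rw [List.pairwise_cons] at hl hl'
      by_cases hab : b = a
      · subst hab
        refine List.Sublist.cons_cons b (ih hl.2 hl'.2 fun t ht => ?_)
        refine (List.mem_cons.1 (h t (List.mem_cons_of_mem _ ht))).resolve_left ?_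
        rintro rfl
        exact hr _ _ (hl.1 t ht) (hl.1 t ht)
      · have hb : b ∈ m := (List.mem_cons.1 (h b List.mem_cons_self)).resolve_left hab
        refine List.Sublist.cons a (ih (List.pairwise_cons.2 hl) hl'.2 fun t ht => ?_)
        refine (List.mem_cons.1 (h t ht)).resolve_left ?_
        rintro rfl
        rcases List.mem_cons.1 ht with rfl | ht
        · exact hab rfl
        · exact hr _ _ (hl.1 t ht) (hl'.1 b hb)

/-! ### Angularly sorted lists of extreme points -/

/-- `l` lists extreme points of `S` other than `p` in angular order around `p`. -/
structure HullListAt (S : Finset Pt) (ε : ℝ) (p : Pt) (l : List Pt) : Prop where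
  sorted : l.Pairwise fun a b => 0 < odet ε p a b
  extreme : ∀ a ∈ l, Extreme S a
  ne : ∀ a ∈ l, a ≠ p

lemma HullListAt.reverse {S : Finset Pt} {ε : ℝ} {p : Pt} {l : List Pt}
    (h : HullListAt S ε p l) : HullListAt S (-ε) p l.reverse where
  sorted := by
    rw [List.pairwise_reverse]
    exact h.sorted.imp fun hab => by rw [odet_neg, odet_swap_right]; linarith
  extreme := fun a ha => h.extreme a (List.mem_reverse.1 ha)
  ne := fun a ha => h.ne a (List.mem_reverse.1 ha)

/-- A hull list may be taken with respect to either orientation. -/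
lemma HullListAt.exists_orient {S : Finset Pt} {ε ε' : ℝ} (hε : IsSign ε) (hε' : IsSign ε')
    {p : Pt} {l : List Pt} (h : HullListAt S ε p l) (σ : Pt → ℤ) :
    ∃ l', HullListAt S ε' p l' ∧ cyclicChanges σ (p :: l') = cyclicChanges σ (p :: l) ∧
      cyclicChanges σ l' = cyclicChanges σ l := by
  have hrev : cyclicChanges σ (p :: l.reverse) = cyclicChanges σ (p :: l) := by
    rw [← cyclicChanges_reverse, List.reverse_cons, List.reverse_reverse,
      cyclicChanges_append_comm]
    rfl
  have hcase : ε' = ε ∨ ε' = -ε := by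
    rcases hε with rfl | rfl <;> rcases hε' with rfl | rfl <;> simp
  rcases hcase with rfl | rfl
  · exact ⟨l, h, rfl, rfl⟩
  · exact ⟨l.reverse, h.reverse, hrev, cyclicChanges_reverse σ l⟩

lemma HullListAt.filter {S T : Finset Pt} {ε : ℝ} {p : Pt} {l : List Pt}
    (h : HullListAt S ε p l) (hT : T ⊆ S) (P : Pt → Prop) [DecidablePred P]
    (hP : ∀ t ∈ l, P t → t ∈ T) :
    HullListAt T ε p (l.filter fun t => P t) where
  sorted := h.sorted.sublist List.filter_sublist
  extreme := fun a ha => by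
    have := List.mem_filter.1 ha
    exact (h.extreme a this.1).mono hT (hP a this.1 (by simpa using this.2))
  ne := fun a ha => h.ne a (List.mem_filter.1 ha).1

lemma HullListAt.sublist {S : Finset Pt} {ε : ℝ} {p : Pt} {l l' : List Pt}
    (h : HullListAt S ε p l) (h' : l'.Pairwise fun a b => 0 < odet ε p a b)
    (hmem : ∀ t ∈ l, t ∈ l') : l.Sublist l' :=
  sublist_of_pairwise (fun _ _ hab => odet_asymm hab) h.sorted h' hmem

/-- A hull list at `p` can be re-read from another extreme point `z`. -/
lemma HullListAt.rebase {S : Finset Pt} (hG : GenPos S) {ε : ℝ} (hε : IsSign ε) {p z : Pt}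
    (hp : Extreme S p) (hz : Extreme S z) (hzp : z ≠ p) {l : List Pt}
    (h : HullListAt S ε p l) (σ : Pt → ℤ) :
    ∃ l', HullListAt S ε z l' ∧ cyclicChanges σ (p :: l) ≤ cyclicChanges σ (z :: l') ∧
      (z ∉ l → cyclicChanges σ (p :: l) ≤ cyclicChanges σ l') := by
  set l₁ := l.filter fun t => 0 < odet ε p t z with hl₁
  set l₂ := l.filter fun t => 0 < odet ε p z t with hl₂
  have m1 : ∀ t, t ∈ l₁ ↔ t ∈ l ∧ 0 < odet ε p t z := fun t => by simp [hl₁]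
  have m2 : ∀ t, t ∈ l₂ ↔ t ∈ l ∧ 0 < odet ε p z t := fun t => by simp [hl₂]
  have s1 : l₁.Pairwise fun a b => 0 < odet ε p a b := h.sorted.sublist List.filter_sublist
  have s2 : l₂.Pairwise fun a b => 0 < odet ε p a b := h.sorted.sublist List.filter_sublist
  have split : ∀ t ∈ l, t ≠ z → t ∈ l₁ ∨ t ∈ l₂ := by
    intro t ht htz
    have := hG.odet_ne hε hp.1 hz.1 (h.extreme t ht).1 hzp.symm (h.ne t ht).symm htz.symm
    rcases lt_or_gt_of_ne this with h' | h'
    · left; rw [m1]; exact ⟨ht, by rw [odet_swap_right]; linarith⟩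
    · right; rw [m2]; exact ⟨ht, h'⟩
  have cross : ∀ a ∈ l₁, ∀ b ∈ l₂, 0 < odet ε p a b := fun a ha b hb =>
    hp.odet_trans hG hε (h.extreme a ((m1 a).1 ha).1).1 hz.1 (h.extreme b ((m2 b).1 hb).1).1
      ((m1 a).1 ha).2 ((m2 b).1 hb).2
  have key : HullListAt S ε z (l₂ ++ p :: l₁) := by
    refine ⟨?_, ?_, ?_⟩
    · rw [List.pairwise_append, List.pairwise_cons]
      refine ⟨?_, ⟨?_, ?_⟩, ?_⟩
      · refine s2.imp_of_mem fun {a b} ha hb hab => ?_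
        exact (h.extreme a ((m2 a).1 ha).1).odet_of_sorted hG hε hp.1 hz.1
          (h.extreme b ((m2 b).1 hb).1).1 ((m2 a).1 ha).2 hab
      · intro a ha
        rw [odet_rot]; exact ((m1 a).1 ha).2
      · refine s1.imp_of_mem fun {a b} ha hb hab => ?_
        rw [odet_rot]
        exact (h.extreme b ((m1 b).1 hb).1).odet_of_sorted hG hε hp.1
          (h.extreme a ((m1 a).1 ha).1).1 hz.1 hab ((m1 b).1 hb).2
      · intro b hb a ha
        rcases List.mem_cons.1 ha with rfl | ha
        · rw [← odet_rot]; exact ((m2 b).1 hb).2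
        · rw [← odet_rot]
          exact hz.odet_of_sorted hG hε hp.1 (h.extreme a ((m1 a).1 ha).1).1
            (h.extreme b ((m2 b).1 hb).1).1 ((m1 a).1 ha).2 ((m2 b).1 hb).2
    · intro a ha
      rcases List.mem_append.1 ha with ha | ha
      · exact h.extreme a ((m2 a).1 ha).1
      · rcases List.mem_cons.1 ha with rfl | ha
        · exact hp
        · exact h.extreme a ((m1 a).1 ha).1
    · rintro a ha rfl
      rcases List.mem_append.1 ha with ha | ha
      · have := ((m2 a).1 ha).2; simp at this
      · rcases List.mem_cons.1 ha with rfl | ha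
        · exact hzp rfl
        · have := ((m1 a).1 ha).2; simp at this
  refine ⟨l₂ ++ p :: l₁, key, ?_, fun hzl => ?_⟩
  · have hs : l.Sublist (l₁ ++ z :: l₂) := by
      refine h.sublist ?_ fun t ht => ?_
      · rw [List.pairwise_append, List.pairwise_cons]
        refine ⟨s1, ⟨fun b hb => ((m2 b).1 hb).2, s2⟩, fun a ha b hb => ?_⟩
        rcases List.mem_cons.1 hb with rfl | hb
        · exact ((m1 a).1 ha).2
        · exact cross a ha b hb
      · by_cases htz : t = z
        · simp [htz]
        · rcases split t ht htz with h' | h' <;> simp [h']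
    calc cyclicChanges σ (p :: l) ≤ cyclicChanges σ ((p :: l₁) ++ (z :: l₂)) :=
          cyclicChanges_sublist σ (List.Sublist.cons_cons p hs)
      _ = cyclicChanges σ ((z :: l₂) ++ (p :: l₁)) := cyclicChanges_append_comm σ _ _
      _ = _ := rfl
  · have hs : l.Sublist (l₁ ++ l₂) := by
      refine h.sublist ?_ fun t ht => ?_
      · rw [List.pairwise_append]
        exact ⟨s1, s2, cross⟩
      · have htz : t ≠ z := by rintro rfl; exact hzl ht
        exact List.mem_append.2 (split t ht htz)
    calc cyclicChanges σ (p :: l) ≤ cyclicChanges σ ((p :: l₁) ++ l₂) :=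
          cyclicChanges_sublist σ (List.Sublist.cons_cons p hs)
      _ = cyclicChanges σ (l₂ ++ (p :: l₁)) := cyclicChanges_append_comm σ _ _

/-! ### Balanced cuts -/

lemma color_eq {σ : Pt → ℤ} (hσ : ∀ t, σ t = 1 ∨ σ t = -1) {a b c : Pt} (hab : σ a ≠ σ b)
    (hbc : σ b ≠ σ c) : σ a = σ c := by
  have h1 := hσ a
  have h2 := hσ b
  have h3 := hσ c
  omega

lemma color_add {σ : Pt → ℤ} (hσ : ∀ t, σ t = 1 ∨ σ t = -1) {a b : Pt} (hab : σ a ≠ σ b) :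
    σ a + σ b = 0 := by
  have h1 := hσ a
  have h2 := hσ b
  omega

lemma cut_cases {S : Finset Pt} (hG : GenPos S) {ε : ℝ} (hε : IsSign ε) {p x t : Pt}
    (hp : p ∈ S) (hx : x ∈ S) (hpx : p ≠ x) (ht : t ∈ S) :
    t = p ∨ t = x ∨ 0 < odet ε p x t ∨ odet ε p x t < 0 := by
  by_cases h1 : t = p
  · exact Or.inl h1
  by_cases h2 : t = x
  · exact Or.inr (Or.inl h2)
  rcases lt_or_gt_of_ne (hG.odet_ne hε hp hx ht hpx (Ne.symm h1) (Ne.symm h2)) with h | h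
  · exact Or.inr (Or.inr (Or.inr h))
  · exact Or.inr (Or.inr (Or.inl h))

lemma sum_cut {S : Finset Pt} (hG : GenPos S) {ε : ℝ} (hε : IsSign ε) {p x : Pt}
    (hp : p ∈ S) (hx : x ∈ S) (hpx : p ≠ x) (σ : Pt → ℤ) :
    ∑ t ∈ S, σ t = σ p + σ x + ∑ t ∈ S.filter (fun t => 0 < odet ε p x t), σ t
      + ∑ t ∈ S.filter (fun t => odet ε p x t < 0), σ t := by
  have hS : S = insert p (insert x (S.filter (fun t => 0 < odet ε p x t)
      ∪ S.filter (fun t => odet ε p x t < 0))) := by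
    ext t
    simp only [Finset.mem_insert, Finset.mem_union, Finset.mem_filter]
    constructor
    · intro ht
      rcases cut_cases hG hε hp hx hpx ht with h | h | h | h <;> simp [h, ht]
    · rintro (rfl | rfl | h | h)
      · exact hp
      · exact hx
      · exact h.1
      · exact h.1
  conv_lhs => rw [hS]
  rw [Finset.sum_insert (by simp [hpx]), Finset.sum_insert (by simp), Finset.sum_union]
  · ring
  · rw [Finset.disjoint_filter]
    intro t _ h
    exact not_lt.2 h.le

/-- All points of `S` lie on one side of the line through `p` and `q`. -/
def IsHullEdge (S : Finset Pt) (p q : Pt) : Prop :=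
  ∃ ε, IsSign ε ∧ ∀ t ∈ S, t ≠ p → t ≠ q → 0 < odet ε p q t

/-- Some line through `p` and a point `x` of the other colour has a balanced open side, and `q`
is a point different from `x` outside this side. -/
def HasCut (σ : Pt → ℤ) (S : Finset Pt) (p q : Pt) : Prop :=
  ∃ ε x, IsSign ε ∧ x ∈ S ∧ σ x ≠ σ p ∧ x ≠ q ∧ ¬ 0 < odet ε p x q ∧
    ∑ t ∈ S.filter (fun t => 0 < odet ε p x t), σ t = 0

/-- The condition on `p` and `q` under which a 1-plane path from `p` to `q` is constructed. -/
def Linkable (σ : Pt → ℤ) (S : Finset Pt) (p q : Pt) : Prop :=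
  IsHullEdge S p q ∨ HasCut σ S p q ∨ HasCut σ S q p

lemma IsHullEdge.symm {S : Finset Pt} {p q : Pt} (h : IsHullEdge S p q) : IsHullEdge S q p := by
  obtain ⟨ε, hε, h⟩ := h
  refine ⟨-ε, hε.neg, fun t ht h1 h2 => ?_⟩
  rw [odet_neg, odet_swap, neg_neg]
  exact h t ht h2 h1

lemma Linkable.symm {σ : Pt → ℤ} {S : Finset Pt} {p q : Pt} (h : Linkable σ S p q) :
    Linkable σ S q p := by
  rcases h with h | h | h
  · exact Or.inl h.symm
  · exact Or.inr (Or.inr h)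
  · exact Or.inr (Or.inl h)

lemma hasCut_of_neg {σ : Pt → ℤ} (hσ : ∀ t, σ t = 1 ∨ σ t = -1) {S : Finset Pt} (hG : GenPos S)
    {p q : Pt} (hp : Extreme S p) (hq : q ∈ S) {ε : ℝ} (hε : IsSign ε)
    (h : σ p * ∑ t ∈ S.filter (fun t => 0 < odet ε p q t), σ t < 0) : HasCut σ S p q := by
  obtain ⟨x, hx, h1, h2⟩ := exists_cut hG hσ hp hε _ (fun t ht => by
    have := Finset.mem_filter.1 ht
    refine Finset.mem_erase.2 ⟨?_, this.1⟩
    rintro rfl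
    simp at this) (fun t ht t' ht' htt' => by
    have := Finset.mem_filter.1 ht
    exact Finset.mem_filter.2 ⟨ht', hp.odet_trans hG hε hq this.1 ht' this.2 htt'⟩) h
  have hx' := Finset.mem_filter.1 hx
  refine ⟨ε, x, hε, hx'.1, h1, ?_, odet_asymm hx'.2, h2⟩
  rintro rfl
  simp at hx'

lemma sum_side_eq_zero {σ : Pt → ℤ} (hσ : ∀ t, σ t = 1 ∨ σ t = -1) {S : Finset Pt}
    (hG : GenPos S) {p q : Pt} (hp : Extreme S p) (hq : q ∈ S) (hpq : σ p ≠ σ q)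
    (hS : ∑ t ∈ S, σ t = 0) (h : ¬ HasCut σ S p q) {ε : ℝ} (hε : IsSign ε) :
    ∑ t ∈ S.filter (fun t => 0 < odet ε p q t), σ t = 0 := by
  have h1 := sum_cut hG hε hp.1 hq (by rintro rfl; exact hpq rfl) σ
  have h2 : S.filter (fun t => odet ε p q t < 0) = S.filter (fun t => 0 < odet (-ε) p q t) :=
    Finset.filter_congr fun t _ => by rw [odet_neg]; constructor <;> intro h <;> linarith
  rw [h2, hS] at h1
  have h3 : ¬ _ := fun h' => h (hasCut_of_neg hσ hG hp hq hε h')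
  have h4 : ¬ _ := fun h' => h (hasCut_of_neg hσ hG hp hq hε.neg h')
  rcases hσ p with h5 | h5 <;> rcases hσ q with h6 | h6 <;> rw [h5] at h1 h3 h4 hpq <;>
    rw [h6] at h1 hpq <;> omega

/-- If `p` and `q` are not linkable then any other point is linkable to `q`. -/
lemma linkable_of_not_linkable {σ : Pt → ℤ} (hσ : ∀ t, σ t = 1 ∨ σ t = -1) {S : Finset Pt}
    (hG : GenPos S) {p q : Pt} (hp : Extreme S p) (hq : q ∈ S) (hpq : σ p ≠ σ q)
    (hS : ∑ t ∈ S, σ t = 0) (h : ¬ Linkable σ S p q) {z : Pt} (hzp : z ≠ p) :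
    Linkable σ S z q := by
  have hcut : ¬ HasCut σ S p q := fun h' => h (Or.inr (Or.inl h'))
  have side : ∀ ε, IsSign ε → ∑ t ∈ S.filter (fun t => 0 < odet ε q p t), σ t = 0 := by
    intro ε hε
    rw [← sum_side_eq_zero hσ hG hp hq hpq hS hcut hε.neg]
    refine Finset.sum_congr (Finset.filter_congr fun t _ => ?_) fun _ _ => rfl
    rw [odet_neg, ← odet_swap]
  refine Or.inr (Or.inr ?_)
  by_cases hz : 0 < odet 1 q p z
  · refine ⟨-1, p, Or.inr rfl, hp.1, hpq, hzp.symm, ?_, side _ (Or.inr rfl)⟩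
    rw [odet_neg]; linarith
  · exact ⟨1, p, Or.inl rfl, hp.1, hpq, hzp.symm, hz, side _ (Or.inl rfl)⟩

/-- Either `p` is linkable to `q`, or the hull neighbour `z` of `p` has the same colour as `p`
and is linkable to `q`. -/
lemma linkable_or_neighbor {σ : Pt → ℤ} (hσ : ∀ t, σ t = 1 ∨ σ t = -1) {S : Finset Pt}
    (hG : GenPos S) {p q z : Pt} (hp : Extreme S p) (hq : q ∈ S) (hpq : σ p ≠ σ q)
    (hS : ∑ t ∈ S, σ t = 0) (hz : z ∈ S) (hzp : z ≠ p) {ε : ℝ} (hε : IsSign ε)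
    (hnb : ∀ t ∈ S, t ≠ p → t ≠ z → 0 < odet ε p z t) :
    Linkable σ S p q ∨ (z ≠ q ∧ σ z = σ p ∧ Linkable σ S z q) := by
  by_cases h : Linkable σ S p q
  · exact Or.inl h
  have hzq : z ≠ q := by
    rintro rfl
    exact h (Or.inl ⟨ε, hε, hnb⟩)
  refine Or.inr ⟨hzq, ?_, linkable_of_not_linkable hσ hG hp hq hpq hS h hzp⟩
  by_contra hc
  have hqp : q ≠ p := by rintro rfl; exact hpq rfl
  refine h (Or.inr (Or.inl ⟨-ε, z, hε.neg, hz, hc, hzq, ?_, ?_⟩))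
  · rw [odet_neg]; linarith [hnb q hq hqp hzq.symm]
  · rw [Finset.filter_false_of_mem, Finset.sum_empty]
    intro t ht h'
    rw [odet_neg] at h'
    by_cases h1 : t = p
    · subst h1; simp at h'
    by_cases h2 : t = z
    · subst h2; simp at h'
    linarith [hnb t ht h1 h2]

/-! ### The two path statements -/

/-- Balanced sets have good paths between linkable extreme points of different colours. -/
def BalancedPaths (σ : Pt → ℤ) (S : Finset Pt) : Prop :=
  ∀ p q, Extreme S p → Extreme S q → σ p ≠ σ q → ∑ t ∈ S, σ t = 0 → Linkable σ S p q →
    ∀ ε l, IsSign ε → HullListAt S ε p l → HasPath σ S p q (cyclicChanges σ (p :: l) - 1)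

/-- Sets with one surplus point have good paths between extreme points of the surplus colour. -/
def SurplusPaths (σ : Pt → ℤ) (S : Finset Pt) : Prop :=
  ∀ p q, Extreme S p → Extreme S q → p ≠ q → σ p = σ q → ∑ t ∈ S, σ t = σ p →
    ∀ ε l, IsSign ε → HullListAt S ε p l → HasPath σ S p q (cyclicChanges σ l)

lemma hasPath_of_cut {σ : Pt → ℤ} (hσ : ∀ t, σ t = 1 ∨ σ t = -1) {S : Finset Pt}
    (hG : GenPos S) (hA : ∀ T, T ⊂ S → BalancedPaths σ T) (hB : ∀ T, T ⊂ S → SurplusPaths σ T)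
    {p q : Pt} (hp : Extreme S p) (hq : Extreme S q) (hpq : σ p ≠ σ q)
    (hS : ∑ t ∈ S, σ t = 0) (hcut : HasCut σ S p q) {ε₀ : ℝ} {l₀ : List Pt} (hε₀ : IsSign ε₀)
    (hl₀ : HullListAt S ε₀ p l₀) : HasPath σ S p q (cyclicChanges σ (p :: l₀) - 1) := by
  obtain ⟨ε, x, hε, hx, hxp, hxq, hq1, hH⟩ := hcut
  obtain ⟨l, hl, hc, -⟩ := hl₀.exists_orient hε₀ hε σ
  rw [← hc]
  have hne : p ≠ x := by rintro rfl; exact hxp rfl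
  have hqp : q ≠ p := by rintro rfl; exact hpq rfl
  have hqneg : odet ε p x q < 0 := by
    rcases cut_cases hG hε hp.1 hx hne hq.1 with h | h | h | h
    · exact (hqp h).elim
    · exact (hxq h.symm).elim
    · exact (hq1 h).elim
    · exact h
  set H := S.filter (fun t => 0 < odet ε p x t) with hHdef
  set N := S.filter (fun t => odet ε p x t < 0) with hNdef
  have mH : ∀ t, t ∈ H ↔ t ∈ S ∧ 0 < odet ε p x t := fun t => by simp [hHdef]
  have mN : ∀ t, t ∈ N ↔ t ∈ S ∧ odet ε p x t < 0 := fun t => by simp [hNdef]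
  have hsum := sum_cut hG hε hp.1 hx hne σ
  rw [← hHdef, ← hNdef, hH, hS] at hsum
  have hcx : σ x = σ q := color_eq hσ hxp hpq
  have hpx0 : σ p + σ x = 0 := color_add hσ hxp.symm
  have hpN : p ∉ N := by simp [mN]
  have hxN : x ∉ N := by simp [mN]
  have hpH : p ∉ H := by simp [mH]
  have hxH : x ∉ H := by simp [mH]
  set T := insert p (insert x H) with hT
  set U := insert x N with hU
  have mT : ∀ t, t ∈ T ↔ t = p ∨ t = x ∨ t ∈ H := fun t => by simp [hT]
  have mU : ∀ t, t ∈ U ↔ t = x ∨ t ∈ N := fun t => by simp [hU]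
  have hTS : T ⊆ S := by
    intro t ht
    rcases (mT t).1 ht with rfl | rfl | h
    exacts [hp.1, hx, ((mH t).1 h).1]
  have hUS : U ⊆ S := by
    intro t ht
    rcases (mU t).1 ht with rfl | h
    exacts [hx, ((mN t).1 h).1]
  have hqT : q ∉ T := by
    rw [mT, mH]
    rintro (h | h | h)
    exacts [hqp h, hxq h.symm, hq1 h.2]
  have hpU : p ∉ U := by
    rw [mU]
    rintro (h | h)
    exacts [hne h, hpN h]
  have hqU : q ∈ U := (mU q).2 (Or.inr ((mN q).2 ⟨hq.1, hqneg⟩))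
  have hTlt : T ⊂ S := Finset.ssubset_iff_subset_ne.2 ⟨hTS, fun h => hqT (h ▸ hq.1)⟩
  have hUlt : U ⊂ S := Finset.ssubset_iff_subset_ne.2 ⟨hUS, fun h => hpU (h ▸ hp.1)⟩
  have hTU : T ∪ U = S := by
    ext t
    rw [Finset.mem_union]
    refine ⟨fun h => h.elim (fun h => hTS h) fun h => hUS h, fun ht => ?_⟩
    rcases cut_cases hG hε hp.1 hx hne ht with h | h | h | h
    · exact Or.inl ((mT t).2 (Or.inl h))
    · exact Or.inl ((mT t).2 (Or.inr (Or.inl h)))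
    · exact Or.inl ((mT t).2 (Or.inr (Or.inr ((mH t).2 ⟨ht, h⟩))))
    · exact Or.inr ((mU t).2 (Or.inr ((mN t).2 ⟨ht, h⟩)))
  have hTpos : ∀ t ∈ T, t ≠ p → t ≠ x → 0 < odet ε p x t := by
    intro t ht h1 h2
    rcases (mT t).1 ht with h | h | h
    exacts [(h1 h).elim, (h2 h).elim, ((mH t).1 h).2]
  have hUpos : ∀ t ∈ U, t ≠ x → 0 < odet (-ε) p x t := by
    intro t ht h1
    rcases (mU t).1 ht with h | h
    · exact (h1 h).elim
    · rw [odet_neg]; linarith [((mN t).1 h).2]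
  have hpT : Extreme T p := hp.mono hTS ((mT p).2 (Or.inl rfl))
  have hxT : Extreme T x := extreme_of_support ((mT x).2 (Or.inr (Or.inl rfl)))
    (odet_self_right ε p x) (fun t ht h1 h2 => hTpos t ht h2 h1) (odet_self_outer ε p x).ge
  have hxU : Extreme U x := extreme_of_support ((mU x).2 (Or.inl rfl))
    (odet_self_right (-ε) p x) (fun t ht h1 _ => hUpos t ht h1) (odet_self_right (-ε) p x).ge
  set a := l.filter (fun t => 0 < odet ε p x t) with ha
  set d := l.filter (fun t => odet ε p x t < 0) with hd
  have ma : ∀ t, t ∈ a ↔ t ∈ l ∧ 0 < odet ε p x t := fun t => by simp [ha]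
  have md : ∀ t, t ∈ d ↔ t ∈ l ∧ odet ε p x t < 0 := fun t => by simp [hd]
  have hdx : ∀ t ∈ d, 0 < odet ε p t x := fun t ht => by
    rw [odet_swap_right]; linarith [((md t).1 ht).2]
  have la : HullListAt T ε p a := hl.filter hTS _ fun t ht h =>
    (mT t).2 (Or.inr (Or.inr ((mH t).2 ⟨(hl.extreme t ht).1, h⟩)))
  have ld : HullListAt U ε p d := hl.filter hUS _ fun t ht h =>
    (mU t).2 (Or.inr ((mN t).2 ⟨(hl.extreme t ht).1, h⟩))
  have lxa : HullListAt T ε p (x :: a) := by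
    refine ⟨List.pairwise_cons.2 ⟨fun t ht => ((ma t).1 ht).2, la.sorted⟩, ?_, ?_⟩
    · exact List.forall_mem_cons.2 ⟨hxT, la.extreme⟩
    · exact List.forall_mem_cons.2 ⟨hne.symm, la.ne⟩
  have ldx : HullListAt U ε x d := by
    refine ⟨?_, ld.extreme, ?_⟩
    · refine ld.sorted.imp_of_mem fun {s t} hs ht hst => ?_
      rw [odet_rot]
      exact (hl.extreme t ((md t).1 ht).1).odet_of_sorted hG hε hp.1
        (hl.extreme s ((md s).1 hs).1).1 hx hst (hdx t ht)
    · rintro t ht rfl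
      have := ((md t).1 ht).2
      simp at this
  have hsub : l.Sublist (d ++ x :: a) := by
    refine hl.sublist ?_ fun t ht => ?_
    · rw [List.pairwise_append]
      refine ⟨ld.sorted, lxa.sorted, fun s hs t ht => ?_⟩
      rcases List.mem_cons.1 ht with rfl | ht
      · exact hdx s hs
      · exact hp.odet_trans hG hε (hl.extreme s ((md s).1 hs).1).1 hx
          (hl.extreme t ((ma t).1 ht).1).1 (hdx s hs) ((ma t).1 ht).2
    · rw [List.mem_append, List.mem_cons, ma, md]
      rcases cut_cases hG hε hp.1 hx hne (hl.extreme t ht).1 with h | h | h | h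
      · exact (hl.ne t ht h).elim
      · exact Or.inr (Or.inl h)
      · exact Or.inr (Or.inr ⟨ht, h⟩)
      · exact Or.inl ⟨ht, h⟩
  have path₁ := hA T hTlt p x hpT hxT hxp.symm (by
    rw [hT, Finset.sum_insert (by simp [hne, hpH]), Finset.sum_insert hxH, hH]; omega)
    (Or.inl ⟨ε, hε, hTpos⟩) ε (x :: a) hε lxa
  have path₂ := hB U hUlt x q hxU (hq.mono hUS hqU) hxq hcx (by
    rw [hU, Finset.sum_insert hxN]; omega) ε d hε ldx
  have hNC : NoCrossPts T U := by
    refine (noCrossPts_of_odet (ε := -ε) hUpos (odet_self_right _ _ _) fun t ht => ?_).symm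
    by_cases h1 : t = p
    · rw [h1]; simp
    by_cases h2 : t = x
    · rw [h2]; simp
    · rw [odet_neg]; linarith [hTpos t ht h1 h2]
  have path := path₁.glue path₂ (fun t h1 h2 => by
    rcases (mU t).1 h2 with h | h
    · exact h
    · rcases (mT t).1 h1 with rfl | h' | h'
      · exact (hpN h).elim
      · exact h'
      · linarith [((mN t).1 h).2, ((mH t).1 h').2]) hNC
  rw [hTU] at path
  refine path.mono ?_
  have e1 : cyclicChanges σ (p :: l) ≤ changes σ (p :: ((d ++ x :: a) ++ [p])) :=
    cyclicChanges_sublist σ (List.Sublist.cons_cons p hsub)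
  have e2 := changes_append σ (p :: d) (a ++ [p]) x
  have e3 := changes_le_cyclicChanges_add_one hσ hxp.symm d
  have e4 : cyclicChanges σ (p :: x :: a) = 1 + changes σ (x :: (a ++ [p])) := by
    change changes σ (p :: x :: (a ++ [p])) = _
    rw [changes_cons_cons, if_neg hxp.symm]
  simp only [List.append_assoc, List.cons_append] at e1 e2 e3
  omega

/-- If no cut at `p` exists and `p q` is a hull edge, then the point following `q` in the angular
order around `p` does not have the colour of `p`. -/
lemma color_second_ne {σ : Pt → ℤ} (hσ : ∀ t, σ t = 1 ∨ σ t = -1) {S : Finset Pt}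
    (hG : GenPos S) {p q c : Pt} (hp : Extreme S p) (hq : q ∈ S) (hpq : σ p ≠ σ q)
    (hS : ∑ t ∈ S, σ t = 0) (hcut : ¬ HasCut σ S p q) {ε : ℝ} (hε : IsSign ε)
    (hedge : ∀ t ∈ S, t ≠ p → t ≠ q → 0 < odet ε p q t) (hc : c ∈ S) (hcp : c ≠ p) (hcq : c ≠ q)
    (hfirst : ∀ t ∈ S, t ≠ p → t ≠ q → t ≠ c → 0 < odet ε p c t) : σ c ≠ σ p := by
  intro hcol
  have hqp : q ≠ p := by rintro rfl; exact hpq rfl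
  set F := ((S.erase p).erase q).erase c with hF
  have mF : ∀ t, t ∈ F ↔ t ≠ c ∧ t ≠ q ∧ t ≠ p ∧ t ∈ S := fun t => by simp [hF]
  have hsum : σ p + (σ q + (σ c + ∑ t ∈ F, σ t)) = 0 := by
    rw [hF, Finset.add_sum_erase _ _ (by simp [hcq, hcp, hc]),
      Finset.add_sum_erase _ _ (by simp [hqp, hq]), Finset.add_sum_erase _ _ hp.1, hS]
  obtain ⟨x, hx, h1, h2⟩ := exists_cut hG hσ hp hε F
    ((Finset.erase_subset _ _).trans (Finset.erase_subset _ _)) (by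
      intro t ht t' ht' h
      obtain ⟨h1, h2, h3, h4⟩ := (mF t).1 ht
      refine (mF t').2 ⟨?_, ?_, ?_, ht'⟩
      · rintro rfl; exact odet_asymm h (hfirst t h4 h3 h2 h1)
      · rintro rfl; exact odet_asymm h (hedge t h4 h3 h2)
      · rintro rfl; simp at h) (by
      have := color_add hσ hpq
      rw [hcol] at hsum
      rcases hσ p with h | h <;> rw [h] at hsum ⊢ <;> omega)
  obtain ⟨-, h3, h4, h5⟩ := (mF x).1 hx
  exact hcut ⟨ε, x, hε, h5, h1, h3, odet_asymm (hedge x h5 h4 h3), h2⟩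

lemma hasPath_of_hullEdge {σ : Pt → ℤ} (hσ : ∀ t, σ t = 1 ∨ σ t = -1) {S : Finset Pt}
    (hG : GenPos S) (hA : ∀ T, T ⊂ S → BalancedPaths σ T) {p q : Pt} (hp : Extreme S p)
    (hq : Extreme S q) (hpq : σ p ≠ σ q) (hS : ∑ t ∈ S, σ t = 0) (hcp : ¬ HasCut σ S p q)
    (hcq : ¬ HasCut σ S q p) (hedge : IsHullEdge S p q) {ε₀ : ℝ} {l₀ : List Pt}
    (hε₀ : IsSign ε₀) (hl₀ : HullListAt S ε₀ p l₀) :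
    HasPath σ S p q (cyclicChanges σ (p :: l₀) - 1) := by
  obtain ⟨ε, hε, hedge⟩ := hedge
  obtain ⟨l, hl, hch, -⟩ := hl₀.exists_orient hε₀ hε σ
  rw [← hch]
  have hne : p ≠ q := by rintro rfl; exact hpq rfl
  set T := (S.erase p).erase q with hT
  have mT : ∀ t, t ∈ T ↔ t ≠ q ∧ t ≠ p ∧ t ∈ S := fun t => by simp [hT]
  have hTS : T ⊆ S := fun t ht => ((mT t).1 ht).2.2
  have hST : insert p (insert q T) = S := by
    rw [hT, Finset.insert_erase (Finset.mem_erase.2 ⟨hne.symm, hq.1⟩),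
      Finset.insert_erase hp.1]
  by_cases hTe : T.Nonempty
  swap
  · rw [Finset.not_nonempty_iff_eq_empty] at hTe
    have hS2 : S = {p, q} := by rw [← hST, hTe]; rfl
    have hs : l.Sublist [q] := hl.sublist (List.pairwise_singleton _ _) fun t ht => by
      have := (hl.extreme t ht).1
      rw [hS2, Finset.mem_insert, Finset.mem_singleton] at this
      simpa using this.resolve_left (hl.ne t ht)
    have h1 := cyclicChanges_sublist σ (List.Sublist.cons_cons p hs)
    have h2 : cyclicChanges σ [p, q] ≤ 2 := by
      simp only [cyclicChanges, List.cons_append, List.nil_append, changes_cons_cons, changes]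
      split_ifs <;> omega
    rw [hS2]
    exact (hasPath_pair hpq).mono (by omega)
  have hedge' : ∀ t ∈ S, t ≠ q → t ≠ p → 0 < odet (-ε) q p t := fun t ht h1 h2 => by
    rw [odet_neg, ← odet_swap]; exact hedge t ht h2 h1
  obtain ⟨c, hc, hcf⟩ := hp.exists_first_around hG hε (F := T) (Finset.erase_subset _ _) hTe
  obtain ⟨d, hd, hdf⟩ := hq.exists_first_around hG hε.neg (F := T) (fun t ht =>
    Finset.mem_erase.2 ⟨((mT t).1 ht).1, hTS ht⟩) hTe
  obtain ⟨hcq', hcp', hcS⟩ := (mT c).1 hc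
  obtain ⟨hdq', hdp', hdS⟩ := (mT d).1 hd
  have hσc : σ c ≠ σ p := color_second_ne hσ hG hp hq.1 hpq hS hcp hε hedge hcS hcp' hcq'
    fun t ht h1 h2 h3 => hcf t ((mT t).2 ⟨h2, h1, ht⟩) h3
  have hσd : σ d ≠ σ q := color_second_ne hσ hG hq hp.1 hpq.symm hS hcq hε.neg hedge' hdS hdq'
    hdp' fun t ht h1 h2 h3 => hdf t ((mT t).2 ⟨h1, h2, ht⟩) h3
  have hcq1 : σ c = σ q := color_eq hσ hσc hpq
  have hdp1 : σ d = σ p := color_eq hσ hσd hpq.symm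
  have hcd : σ c ≠ σ d := by rw [hcq1]; exact hσd.symm
  have hcd' : c ≠ d := by rintro rfl; exact hcd rfl
  have hpT : p ∉ T := by simp [mT]
  have hqT : q ∉ T := by simp [mT]
  have hTlt : T ⊂ S := Finset.ssubset_iff_subset_ne.2 ⟨hTS, fun h => hpT (h ▸ hp.1)⟩
  have hGT := hG.mono hTS
  have hsum : ∑ t ∈ T, σ t = 0 := by
    have h1 := Finset.add_sum_erase S σ hp.1
    have h2 := Finset.add_sum_erase (S.erase p) σ (Finset.mem_erase.2 ⟨hne.symm, hq.1⟩)
    have := color_add hσ hpq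
    rw [← hT] at h2
    omega
  have hcT : Extreme T c := extreme_of_support hc (odet_self_right ε p c)
    (fun t ht h1 _ => hcf t ht h1) (odet_self_right ε p c).ge
  have hdT : Extreme T d := extreme_of_support hd (odet_self_right (-ε) q d)
    (fun t ht h1 _ => hdf t ht h1) (odet_self_right (-ε) q d).ge
  have hpqt : ∀ t ∈ T, 0 < odet ε p q t := fun t ht =>
    hedge t (hTS ht) ((mT t).1 ht).2.1 ((mT t).1 ht).1
  have hqdt : ∀ t ∈ T, t ≠ d → 0 < odet ε d q t := fun t ht h => by
    rw [odet_swap, ← odet_neg]; exact hdf t ht h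
  -- the sorted list around `c`
  set m := l.filter (fun t => t ≠ q ∧ t ≠ c ∧ t ≠ d) with hm
  have mm : ∀ t, t ∈ m ↔ t ∈ l ∧ t ≠ q ∧ t ≠ c ∧ t ≠ d := fun t => by simp [hm]
  have mmT : ∀ t ∈ m, t ∈ T := fun t ht => by
    obtain ⟨h1, h2, -, -⟩ := (mm t).1 ht
    exact (mT t).2 ⟨h2, hl.ne t h1, (hl.extreme t h1).1⟩
  have lm : HullListAt T ε p m := hl.filter hTS (fun t => t ≠ q ∧ t ≠ c ∧ t ≠ d) fun t ht h =>
    (mT t).2 ⟨h.1, hl.ne t ht, (hl.extreme t ht).1⟩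
  have hcm : ∀ t ∈ m, 0 < odet ε p c t := fun t ht => hcf t (mmT t ht) ((mm t).1 ht).2.2.1
  have hcmd : ∀ t ∈ m, 0 < odet ε c t d := by
    intro t ht
    obtain ⟨h1, h2, h3, h4⟩ := (mm t).1 ht
    have htE := hl.extreme t h1
    by_contra hneg
    have hlt : 0 < odet ε c d t := by
      have := hG.odet_ne hε hcS htE.1 hdS h3.symm hcd' h4
      rw [odet_swap_right]
      exact neg_pos.2 (lt_of_le_of_ne (not_lt.1 hneg) this)
    have key : odet ε d p t * odet ε d q c
        = odet ε d p c * odet ε d q t + odet ε d p q * odet ε c d t := by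
      unfold odet det2; ring
    have k1 : 0 < odet ε d q c := hqdt c hc hcd'
    have k2 : 0 < odet ε d p c := by rw [odet_rot]; exact hcf d hd hcd'.symm
    have k3 : 0 < odet ε d p q := by rw [odet_rot]; exact hpqt d hd
    have k4 := hqdt t (mmT t ht) h4
    have k5 : 0 < odet ε d p t * odet ε d q c := by
      rw [key]; exact add_pos (mul_pos k2 k4) (mul_pos k3 hlt)
    have k6 : 0 < odet ε d p t := (pos_iff_pos_of_mul_pos k5).2 k1
    refine htE.not_odet hε hdS hp.1 hcS ?_ ?_ ?_
    · rw [odet_rot]; exact k6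
    · rw [odet_rot]; exact hcm t ht
    · rw [odet_rot]; exact hlt
  have lc : HullListAt T ε c (m ++ [d]) := by
    refine ⟨?_, ?_, ?_⟩
    · rw [List.pairwise_append]
      refine ⟨?_, List.pairwise_singleton _ _, fun s hs t ht => ?_⟩
      · refine lm.sorted.imp_of_mem fun {s t} hs ht hst => ?_
        exact (hl.extreme s ((mm s).1 hs).1).odet_of_sorted hG hε hp.1 hcS
          (hTS (mmT t ht)) (hcm s hs) hst
      · rw [List.mem_singleton.1 ht]; exact hcmd s hs
    · intro t ht
      rcases List.mem_append.1 ht with h | h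
      · exact lm.extreme t h
      · rw [List.mem_singleton.1 h]; exact hdT
    · intro t ht
      rcases List.mem_append.1 ht with h | h
      · exact ((mm t).1 h).2.2.1
      · rw [List.mem_singleton.1 h]; exact hcd'.symm
  have hqcm : ((q :: c :: m).Pairwise fun a b => 0 < odet ε p a b) := by
    refine List.pairwise_cons.2 ⟨fun t ht => ?_, List.pairwise_cons.2 ⟨hcm, lm.sorted⟩⟩
    rcases List.mem_cons.1 ht with rfl | ht
    · exact hpqt t hc
    · exact hpqt t (mmT t ht)
  have hsub : l.Sublist ((q :: c :: m) ++ [d]) := by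
    by_cases hdl : d ∈ l
    · refine hl.sublist ?_ fun t ht => ?_
      · rw [List.pairwise_append]
        refine ⟨hqcm, List.pairwise_singleton _ _, fun s hs t ht => ?_⟩
        rw [List.mem_singleton.1 ht]
        rcases List.mem_cons.1 hs with rfl | hs
        · exact hpqt d hd
        rcases List.mem_cons.1 hs with rfl | hs
        · exact hcf d hd hcd'.symm
        · have hsT := mmT s hs
          obtain ⟨h1, h2, h3, h4⟩ := (mm s).1 hs
          by_contra hneg
          have hlt : 0 < odet ε p d s := by
            have := hG.odet_ne hε hp.1 (hTS hsT) hdS ((mT s).1 hsT).2.1.symm hdp'.symm h4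
            rw [odet_swap_right]
            exact neg_pos.2 (lt_of_le_of_ne (not_lt.1 hneg) this)
          have := (hl.extreme d hdl).odet_of_sorted hG hε hp.1 hq.1 (hTS hsT) (hpqt d hd) hlt
          have h5 := hqdt s hsT h4
          rw [odet_swap] at h5
          linarith
      · rw [List.mem_append, List.mem_cons, List.mem_cons, List.mem_singleton, mm]
        tauto
    · refine (hl.sublist hqcm fun t ht => ?_).trans (List.sublist_append_left _ _)
      have : t ≠ d := by rintro rfl; exact hdl ht
      rw [List.mem_cons, List.mem_cons, mm]
      tauto
  have hcount : cyclicChanges σ (p :: l) - 1 ≤ cyclicChanges σ (c :: (m ++ [d])) - 1 := by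
    have e1 : cyclicChanges σ (p :: l) ≤ changes σ (p :: (((q :: c :: m) ++ [d]) ++ [p])) :=
      cyclicChanges_sublist σ (List.Sublist.cons_cons p hsub)
    have e2 : changes σ (p :: (((q :: c :: m) ++ [d]) ++ [p]))
        = 1 + (0 + changes σ (c :: ((m ++ [d]) ++ [p]))) := by
      simp only [List.cons_append, changes_cons_cons]
      rw [if_neg hpq, if_pos hcq1.symm]
    have e3 := changes_append σ (c :: m) [p] d
    have e4 := changes_append σ (c :: m) [c] d
    have e5 : changes σ [d, p] = 0 := by simp [changes, hdp1]
    have e6 : changes σ [d, c] = 1 := by simp [changes, hcd.symm]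
    have e7 : cyclicChanges σ (c :: (m ++ [d])) = changes σ (c :: ((m ++ [d]) ++ [c])) := rfl
    simp only [List.append_assoc, List.cons_append, List.nil_append] at *
    omega
  have hNp : NoCrossEdge p c T := noCrossEdge_of_odet (ε := ε) (u := p) (v := c) (w := c) hcf
    (odet_self_right _ _ _) (odet_self_outer _ _ _).le (odet_self_right _ _ _).le
  obtain ⟨e, he, hed, hnb⟩ := hdT.exists_neighbor hGT hε hc hcd'
  rcases linkable_or_neighbor hσ hGT hdT hc hcd.symm hsum he hed hε hnb with h | ⟨hec, hσe, h⟩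
  · have path := hA T hTlt c d hcT hdT hcd hsum h.symm ε _ hε lc
    have hNq : NoCrossEdge d q T := noCrossEdge_of_odet (ε := -ε) (u := q) (v := d) (w := d) hdf
      (odet_self_right _ _ _) (odet_self_right _ _ _).le (odet_self_outer _ _ _).le
    have := path.peel hpT hqT hne hσc.symm hσd hNp hNq
    rw [hST] at this
    exact this.mono hcount
  · have heT : Extreme T e := extreme_of_support he (odet_self_right ε d e)
      (fun t ht h1 h2 => hnb t ht h2 h1) (odet_self_outer ε d e).ge
    have hce : σ c ≠ σ e := by rw [hσe]; exact hcd
    have path := hA T hTlt c e hcT heT hce hsum h.symm ε _ hε lc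
    have hNq : NoCrossEdge e q T := by
      refine (noCrossEdge_of_odet_neg (ε := ε) (u := d) (v := e) ?_ ?_
        (odet_self_right _ _ _).le).symm
      · intro t ht
        by_cases h1 : t = d
        · rw [h1]; simp
        by_cases h2 : t = e
        · rw [h2]; simp
        exact (hnb t ht h1 h2).le
      · have := hqdt e he hed
        rw [odet_swap_right] at this
        linarith
    have := path.peel hpT hqT hne hσc.symm (by rw [hσe]; exact hσd) hNp hNq
    rw [hST] at this
    exact this.mono hcount

lemma balancedPaths_step {σ : Pt → ℤ} (hσ : ∀ t, σ t = 1 ∨ σ t = -1) {S : Finset Pt}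
    (hG : GenPos S) (hA : ∀ T, T ⊂ S → BalancedPaths σ T)
    (hB : ∀ T, T ⊂ S → SurplusPaths σ T) : BalancedPaths σ S := by
  intro p q hp hq hpq hS hlink ε l hε hl
  by_cases h1 : HasCut σ S p q
  · exact hasPath_of_cut hσ hG hA hB hp hq hpq hS h1 hε hl
  by_cases h2 : HasCut σ S q p
  · obtain ⟨l', hl', hle, -⟩ := hl.rebase hG hε hp hq (by rintro rfl; exact hpq rfl) σ
    exact (hasPath_of_cut hσ hG hA hB hq hp hpq.symm hS h2 hε hl').symm.mono (by omega)
  · exact hasPath_of_hullEdge hσ hG hA hp hq hpq hS h1 h2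
      (hlink.resolve_right (by rintro (h | h); exacts [h1 h, h2 h])) hε hl

lemma hasPath_of_neighbor_ne {σ : Pt → ℤ} (hσ : ∀ t, σ t = 1 ∨ σ t = -1) {S : Finset Pt}
    (hG : GenPos S) (hA : ∀ T, T ⊂ S → BalancedPaths σ T) {p q x : Pt} (hp : Extreme S p)
    (hq : Extreme S q) (hne : p ≠ q) (hpq : σ p = σ q) (hS : ∑ t ∈ S, σ t = σ p) (hx : x ∈ S)
    {ε : ℝ} (hε : IsSign ε) (hnb : ∀ t ∈ S, t ≠ p → t ≠ x → 0 < odet ε p x t)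
    (hxp : σ x ≠ σ p) {ε₀ : ℝ} {l₀ : List Pt} (hε₀ : IsSign ε₀) (hl₀ : HullListAt S ε₀ p l₀) :
    HasPath σ S p q (cyclicChanges σ l₀) := by
  obtain ⟨l, hl, -, hch⟩ := hl₀.exists_orient hε₀ hε σ
  rw [← hch]
  have hxp' : x ≠ p := by rintro rfl; exact hxp rfl
  have hxq : σ x ≠ σ q := by rw [← hpq]; exact hxp
  have hqx : q ≠ x := by rintro rfl; exact hxq rfl
  set T := S.erase p with hT
  have hTS : T ⊆ S := Finset.erase_subset _ _
  have hGT := hG.mono hTS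
  have hpT : p ∉ T := Finset.notMem_erase _ _
  have hTlt : T ⊂ S := Finset.erase_ssubset hp.1
  have hST : insert p T = S := Finset.insert_erase hp.1
  have mT : ∀ t, t ∈ T ↔ t ≠ p ∧ t ∈ S := fun t => Finset.mem_erase
  have hsum : ∑ t ∈ T, σ t = 0 := by
    have := Finset.add_sum_erase S σ hp.1
    rw [← hT] at this
    omega
  have hnb' : ∀ t ∈ T, t ≠ x → 0 < odet ε p x t := fun t ht h =>
    hnb t (hTS ht) ((mT t).1 ht).1 h
  have hxT' : x ∈ T := (mT x).2 ⟨hxp', hx⟩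
  have hqT' : q ∈ T := (mT q).2 ⟨hne.symm, hq.1⟩
  have hxT : Extreme T x := extreme_of_support hxT' (odet_self_right ε p x)
    (fun t ht h1 _ => hnb' t ht h1) (odet_self_right ε p x).ge
  have hqT : Extreme T q := hq.mono hTS hqT'
  set m := l.filter (fun t => t ≠ x) with hm
  have mm : ∀ t, t ∈ m ↔ t ∈ l ∧ t ≠ x := fun t => by simp [hm]
  have lm : HullListAt T ε p m := hl.filter hTS (fun t => t ≠ x) fun t ht _ =>
    (mT t).2 ⟨hl.ne t ht, (hl.extreme t ht).1⟩
  have hxm : ∀ t ∈ m, 0 < odet ε p x t := fun t ht => hnb' t (lm.extreme t ht).1 ((mm t).1 ht).2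
  have lx : HullListAt T ε x m := by
    refine ⟨?_, lm.extreme, fun t ht => ((mm t).1 ht).2⟩
    refine lm.sorted.imp_of_mem fun {s t} hs ht hst => ?_
    exact (hl.extreme s ((mm s).1 hs).1).odet_of_sorted hG hε hp.1 hx
      (hl.extreme t ((mm t).1 ht).1).1 (hxm s hs) hst
  have hcount : cyclicChanges σ l ≤ cyclicChanges σ (x :: m) := by
    refine cyclicChanges_sublist σ (hl.sublist (List.pairwise_cons.2 ⟨hxm, lm.sorted⟩) ?_)
    intro t ht
    rw [List.mem_cons, mm]
    tauto
  obtain ⟨z, hz, hzx, hnz⟩ := hxT.exists_neighbor hGT hε.neg hqT' hqx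
  rcases linkable_or_neighbor hσ hGT hxT hqT' hxq hsum hz hzx hε.neg hnz with h | ⟨hzq, hσz, h⟩
  · have path := hA T hTlt x q hxT hqT hxq hsum h ε m hε lx
    have := path.cons hpT hxp.symm (noCrossEdge_of_odet (ε := ε) (u := p) (v := x) (w := x) hnb'
      (odet_self_right _ _ _) (odet_self_outer _ _ _).le (odet_self_right _ _ _).le)
    rw [hST] at this
    exact this.mono (by omega)
  · have hzT : Extreme T z := extreme_of_support hz (odet_self_right (-ε) x z)
      (fun t ht h1 h2 => hnz t ht h2 h1) (odet_self_outer (-ε) x z).ge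
    obtain ⟨l', hl', hle, -⟩ := lx.rebase hGT hε hxT hzT hzx σ
    have path := hA T hTlt z q hzT hqT (by rw [hσz]; exact hxq) hsum h ε l' hε hl'
    have := path.cons hpT (by rw [hσz]; exact hxp.symm)
      (noCrossEdge_of_odet_neg (ε := -ε) (u := x) (v := z) (fun t ht => by
        by_cases h1 : t = x
        · rw [h1]; simp
        by_cases h2 : t = z
        · rw [h2]; simp
        exact (hnz t ht h1 h2).le) (by
        have := hnb' z hz hzx
        rw [odet_rot] at this
        rw [odet_neg]; linarith) (odet_self_right _ _ _).le)
    rw [hST] at this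
    exact this.mono (by omega)

/-- If the line through `u` and `w` separates `q` from `p` and the extreme point `a`, and `q`
precedes `a` and `w` in the angular order around `p`, then `w` precedes `a`. -/
lemma odet_pos_of_separating {S : Finset Pt} (hG : GenPos S) {ε : ℝ} (hε : IsSign ε)
    {p q a u w : Pt} (hp : p ∈ S) (hq : q ∈ S) (ha : Extreme S a) (hw : w ∈ S)
    (hap : a ≠ p) (haw : a ≠ w) (hwp : w ≠ p) (hqa : 0 < odet ε p q a) (hqw : 0 < odet ε p q w)
    (hup : 0 ≤ odet ε u w p) (hua : 0 ≤ odet ε u w a) (huq : odet ε u w q < 0) :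
    0 < odet ε p w a := by
  by_contra hneg
  have h1 : 0 < odet ε p a w := by
    have := hG.odet_ne hε hp hw ha.1 hwp.symm hap.symm haw.symm
    rw [odet_swap_right]
    exact neg_pos.2 (lt_of_le_of_ne (not_lt.1 hneg) this)
  have h2 := ha.odet_of_sorted hG hε hp hq hw hqa h1
  have key : odet ε w p a * odet ε u w q
      = odet ε w q a * odet ε u w p + odet ε w p q * odet ε u w a := by
    unfold odet det2; ring
  have h3 : 0 < odet ε w p a := by rw [odet_rot]; exact h1
  have h4 : 0 < odet ε w q a := by rw [odet_rot]; exact h2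
  have h5 : 0 < odet ε w p q := by rw [odet_rot]; exact hqw
  have h6 := mul_neg_of_pos_of_neg h3 huq
  have h7 := mul_nonneg h4.le hup
  have h8 := mul_nonneg h5.le hua
  linarith

set_option maxHeartbeats 4000000 in
lemma hasPath_of_neighbors_eq {σ : Pt → ℤ} (hσ : ∀ t, σ t = 1 ∨ σ t = -1) {S : Finset Pt}
    (hG : GenPos S) (hA : ∀ T, T ⊂ S → BalancedPaths σ T)
    (hB : ∀ T, T ⊂ S → SurplusPaths σ T) {p q : Pt} (hp : Extreme S p)
    (hq : Extreme S q) (hne : p ≠ q) (hpq : σ p = σ q) (hS : ∑ t ∈ S, σ t = σ p)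
    (hnb : ∀ ε x, IsSign ε → x ∈ S → x ≠ p →
      (∀ t ∈ S, t ≠ p → t ≠ x → 0 < odet ε p x t) → σ x = σ p)
    {ε₀ : ℝ} {l₀ : List Pt} (hε₀ : IsSign ε₀) (hl₀ : HullListAt S ε₀ p l₀) :
    HasPath σ S p q (cyclicChanges σ l₀) := by
  -- choose the orientation for which the far side of `q` lacks the colour of `p`
  obtain ⟨ε, hε, hside⟩ : ∃ ε, IsSign ε ∧
      σ p * ∑ t ∈ S.filter (fun t => 0 < odet ε p q t), σ t < 0 := by
    have h1 := sum_cut hG (Or.inl rfl : IsSign 1) hp.1 hq.1 hne σ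
    have h2 : S.filter (fun t => odet 1 p q t < 0) = S.filter (fun t => 0 < odet (-1) p q t) :=
      Finset.filter_congr fun t _ => by rw [odet_neg]; constructor <;> intro h <;> linarith
    rw [h2, hS, ← hpq] at h1
    by_contra hcon
    have h3 : ¬ _ := fun h => hcon ⟨1, Or.inl rfl, h⟩
    have h4 : ¬ _ := fun h => hcon ⟨-1, Or.inr rfl, h⟩
    rcases hσ p with h5 | h5 <;> rw [h5] at h1 h3 h4 <;> omega
  obtain ⟨l, hl, -, hch⟩ := hl₀.exists_orient hε₀ hε σ
  rw [← hch]
  obtain ⟨x, hxF, hxp, hH⟩ := exists_cut hG hσ hp hε _ (fun t ht => by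
    have := Finset.mem_filter.1 ht
    refine Finset.mem_erase.2 ⟨?_, this.1⟩
    rintro rfl
    simp at this) (fun t ht t' ht' htt' => by
    have := Finset.mem_filter.1 ht
    exact Finset.mem_filter.2 ⟨ht', hp.odet_trans hG hε hq.1 this.1 ht' this.2 htt'⟩) hside
  obtain ⟨hx, hqx⟩ := Finset.mem_filter.1 hxF
  have hpx : p ≠ x := by rintro rfl; exact hxp rfl
  set H := S.filter (fun t => 0 < odet ε p x t) with hHdef
  set U := S.filter (fun t => odet ε p x t < 0) with hUdef
  have mH : ∀ t, t ∈ H ↔ t ∈ S ∧ 0 < odet ε p x t := fun t => by simp [hHdef]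
  have mU : ∀ t, t ∈ U ↔ t ∈ S ∧ odet ε p x t < 0 := fun t => by simp [hUdef]
  have hsum := sum_cut hG hε hp.1 hx hpx σ
  have hpx0 := color_add hσ hxp.symm
  rw [← hHdef, ← hUdef, hH, hS, hpx0] at hsum
  have hsumU : ∑ t ∈ U, σ t = σ p := by omega
  set T := insert p (insert x H) with hT
  have mT : ∀ t, t ∈ T ↔ t = p ∨ t = x ∨ t ∈ H := fun t => by simp [hT]
  have hsumT : ∑ t ∈ T, σ t = 0 := by
    rw [hT, Finset.sum_insert (by simp [hpx, mH]), Finset.sum_insert (by simp [mH]), hH]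
    omega
  have hTS : T ⊆ S := by
    intro t ht
    rcases (mT t).1 ht with rfl | rfl | h
    exacts [hp.1, hx, ((mH t).1 h).1]
  have hUS : U ⊆ S := Finset.filter_subset _ _
  have hTU : ∀ t ∈ S, t ∈ T ∨ t ∈ U := by
    intro t ht
    rcases cut_cases hG hε hp.1 hx hpx ht with h | h | h | h
    · exact Or.inl ((mT t).2 (Or.inl h))
    · exact Or.inl ((mT t).2 (Or.inr (Or.inl h)))
    · exact Or.inl ((mT t).2 (Or.inr (Or.inr ((mH t).2 ⟨ht, h⟩))))
    · exact Or.inr ((mU t).2 ⟨ht, h⟩)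
  have hdisj : ∀ t ∈ T, t ∉ U := by
    intro t ht hU
    have hneg := ((mU t).1 hU).2
    rcases (mT t).1 ht with rfl | rfl | h
    · simp at hneg
    · simp at hneg
    · linarith [((mH t).1 h).2]
  have hTpos : ∀ t ∈ T, t ≠ p → t ≠ x → 0 < odet ε p x t := by
    intro t ht h1 h2
    rcases (mT t).1 ht with h | h | h
    exacts [(h1 h).elim, (h2 h).elim, ((mH t).1 h).2]
  have hpT : p ∈ T := (mT p).2 (Or.inl rfl)
  have hxT : x ∈ T := (mT x).2 (Or.inr (Or.inl rfl))
  have hqU : q ∈ U := (mU q).2 ⟨hq.1, odet_neg_of_pos hqx⟩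
  have hqT : q ∉ T := fun h => hdisj q h hqU
  have hpU : p ∉ U := hdisj p hpT
  -- points of `U` precede points of `T` around `p`
  have hUT : ∀ o ∈ U, ∀ t ∈ T, t ≠ p → 0 < odet ε p o t := by
    intro o ho t ht htp
    have h1 : 0 < odet ε p o x := by rw [odet_swap_right]; linarith [((mU o).1 ho).2]
    by_cases htx : t = x
    · rw [htx]; exact h1
    · exact hp.odet_trans hG hε (hUS ho) hx (hTS ht) h1 (hTpos t ht htp htx)
  -- the hull neighbour of `p` on the side of `U`
  obtain ⟨v, hv, hvp, hvf⟩ := hp.exists_neighbor hG hε hq.1 hne.symm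
  have hσv : σ v = σ p := hnb ε v hε hv hvp hvf
  have hvx : v ≠ x := by rintro rfl; exact hxp hσv
  have hvU : v ∈ U := (mU v).2 ⟨hv, odet_neg_of_pos (hvf x hx hpx.symm hvx.symm)⟩
  have hvE : Extreme S v := extreme_of_support hv (odet_self_right ε p v)
    (fun t ht h1 h2 => hvf t ht h2 h1) (odet_self_outer ε p v).ge
  -- separating edges of `T`, and the extremal one with respect to `q`
  set Next : Pt → Pt → Prop := fun u e => u ∈ T ∧ e ∈ T ∧
    (∀ t ∈ T, t ≠ u → t ≠ e → 0 < odet ε u e t) ∧ ∀ o ∈ U, odet ε u e o < 0 with hNext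
  set E := T.filter (fun e => σ e ≠ σ p ∧ ∃ u, Next u e) with hE
  have hxE : x ∈ E := Finset.mem_filter.2 ⟨hxT, hxp, p, hpT, hxT, hTpos,
    fun o ho => ((mU o).1 ho).2⟩
  obtain ⟨w, hwE, hwmin⟩ := hq.exists_first_around hG hε (F := E) (fun t ht =>
    Finset.mem_erase.2 ⟨by rintro rfl; exact hqT (Finset.mem_filter.1 ht).1,
      hTS (Finset.mem_filter.1 ht).1⟩) ⟨x, hxE⟩
  obtain ⟨hwT, hσw, u, huT, -, huw, huwU⟩ := Finset.mem_filter.1 hwE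
  have hwp : w ≠ p := by rintro rfl; exact hσw rfl
  have hwU : w ∉ U := hdisj w hwT
  have hwq : σ w ≠ σ q := by rw [← hpq]; exact hσw
  have huwT : ∀ t ∈ T, 0 ≤ odet ε u w t := by
    intro t ht
    by_cases h1 : t = u
    · rw [h1]; simp
    by_cases h2 : t = w
    · rw [h2]; simp
    exact (huw t ht h1 h2).le
  have hpT' : Extreme T p := hp.mono hTS hpT
  have hwT' : Extreme T w := extreme_of_support hwT (odet_self_right ε u w)
    (fun t ht h1 h2 => huw t ht h2 h1) (odet_self_outer ε u w).ge
  have hTlt : T ⊂ S := Finset.ssubset_iff_subset_ne.2 ⟨hTS, fun h => hqT (h ▸ hq.1)⟩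
  -- the second part, extended by `w`
  set Y := insert w U with hY
  have mY : ∀ t, t ∈ Y ↔ t = w ∨ t ∈ U := fun t => by simp [hY]
  have hYS : Y ⊆ S := Finset.insert_subset (hTS hwT) hUS
  have hpY : p ∉ Y := by
    rw [mY]
    rintro (h | h)
    exacts [hwp h.symm, hpU h]
  have hYlt : Y ⊂ S := Finset.ssubset_iff_subset_ne.2 ⟨hYS, fun h => hpY (h ▸ hp.1)⟩
  have hGY := hG.mono hYS
  have hwY : w ∈ Y := Finset.mem_insert_self _ _
  have hqY : q ∈ Y := Finset.mem_insert_of_mem hqU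
  have hsumY : ∑ t ∈ Y, σ t = 0 := by
    rw [hY, Finset.sum_insert hwU, hsumU]
    exact color_add hσ hσw
  have hYneg : ∀ t ∈ Y, t ≠ w → 0 < odet (-ε) u w t := by
    intro t ht h
    rw [odet_neg]
    linarith [huwU t (((mY t).1 ht).resolve_left h)]
  have hwY' : Extreme Y w := extreme_of_support hwY (odet_self_right (-ε) u w)
    (fun t ht h1 _ => hYneg t ht h1) (odet_self_right (-ε) u w).ge
  have hqY' : Extreme Y q := hq.mono hYS hqY
  have hqw' : q ≠ w := by rintro rfl; exact hwU hqU
  -- the two sorted lists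
  set d := l.filter (fun t => t ∈ U ∧ t ≠ v) with hd
  set a := l.filter (fun t => t ∈ T ∧ t ≠ w) with ha
  have md : ∀ t, t ∈ d ↔ t ∈ l ∧ t ∈ U ∧ t ≠ v := fun t => by simp [hd]
  have ma : ∀ t, t ∈ a ↔ t ∈ l ∧ t ∈ T ∧ t ≠ w := fun t => by simp [ha]
  have hap : ∀ t ∈ a, t ≠ p := fun t ht => hl.ne t ((ma t).1 ht).1
  have sd : d.Pairwise fun s t => 0 < odet ε p s t := hl.sorted.sublist List.filter_sublist
  have sa : a.Pairwise fun s t => 0 < odet ε p s t := hl.sorted.sublist List.filter_sublist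
  have hvd : (v :: d).Pairwise fun s t => 0 < odet ε p s t :=
    List.pairwise_cons.2 ⟨fun t ht => hvf t (hUS ((md t).1 ht).2.1)
      (hl.ne t ((md t).1 ht).1) ((md t).1 ht).2.2, sd⟩
  have hvdU : ∀ t ∈ v :: d, t ∈ U := List.forall_mem_cons.2
    ⟨hvU, fun t ht => ((md t).1 ht).2.1⟩
  have hvdE : ∀ t ∈ v :: d, Extreme S t := List.forall_mem_cons.2
    ⟨hvE, fun t ht => hl.extreme t ((md t).1 ht).1⟩
  have lvd : HullListAt Y ε w (v :: d) := by
    refine ⟨?_, fun t ht => (hvdE t ht).mono hYS (Finset.mem_insert_of_mem (hvdU t ht)), ?_⟩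
    · refine hvd.imp_of_mem fun {s t} hs ht hst => ?_
      rw [odet_rot]
      exact (hvdE t ht).odet_of_sorted hG hε hp.1 (hUS (hvdU s hs)) (hTS hwT) hst
        (hUT t (hvdU t ht) w hwT hwp)
    · rintro t ht rfl
      exact hwU (hvdU t ht)
  have separated : ∀ (u w : Pt), w ∈ T → w ≠ p → (∀ t ∈ T, 0 ≤ odet ε u w t) →
      odet ε u w q < 0 → ∀ t ∈ l, t ∈ T → t ≠ w → 0 < odet ε p w t := by
    intro u w hwT hwp hpos hneg t htl ht htw
    exact odet_pos_of_separating hG hε hp.1 hq.1 (hl.extreme t htl) (hTS hwT) (hl.ne t htl) htw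
      hwp (hUT q hqU t ht (hl.ne t htl)) (hUT q hqU w hwT hwp) (hpos p hpT) (hpos t ht) hneg
  have hwa : ∀ t ∈ a, 0 < odet ε p w t := fun t ht =>
    separated u w hwT hwp huwT (huwU q hqU) t ((ma t).1 ht).1 ((ma t).1 ht).2.1 ((ma t).1 ht).2.2
  have hsub : l.Sublist ((v :: d) ++ w :: a) := by
    refine hl.sublist ?_ fun t ht => ?_
    · rw [List.pairwise_append]
      refine ⟨hvd, List.pairwise_cons.2 ⟨hwa, sa⟩, fun s hs t ht => ?_⟩
      rcases List.mem_cons.1 ht with rfl | ht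
      · exact hUT s (hvdU s hs) t hwT hwp
      · exact hUT s (hvdU s hs) t ((ma t).1 ht).2.1 (hap t ht)
    · rw [List.mem_append, List.mem_cons, List.mem_cons, md, ma]
      rcases hTU t (hl.extreme t ht).1 with h | h <;> tauto
  have hcount : cyclicChanges σ l
      ≤ changes σ (v :: (d ++ [w])) + changes σ (w :: (a ++ [p])) := by
    have e1 : cyclicChanges σ l ≤ changes σ ((v :: d) ++ w :: (a ++ [v])) := by
      refine (cyclicChanges_sublist σ hsub).trans (le_of_eq ?_)
      simp only [cyclicChanges, List.cons_append, List.append_assoc]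
    rw [changes_append] at e1
    have e2 := changes_congr_last σ hσv (w :: a)
    simp only [List.cons_append] at e1 e2
    omega
  have hcw : cyclicChanges σ (w :: v :: d) = 1 + changes σ (v :: (d ++ [w])) := by
    change changes σ (w :: v :: (d ++ [w])) = _
    rw [changes_cons_cons, if_neg (by rw [hσv]; exact hσw)]
  by_cases hlink : Linkable σ Y w q
  · -- glue at `w`
    have hlinkT : Linkable σ T p w := by
      by_cases hwx : w = x
      · rw [hwx]; exact Or.inl ⟨ε, hε, hTpos⟩
      · refine Or.inr (Or.inl ⟨-ε, x, hε.neg, hxT, hxp, Ne.symm hwx, ?_, ?_⟩)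
        · rw [odet_neg]; linarith [hTpos w hwT hwp hwx]
        · rw [Finset.filter_false_of_mem, Finset.sum_empty]
          intro t ht h'
          rw [odet_neg] at h'
          by_cases h1 : t = p
          · subst h1; simp at h'
          by_cases h2 : t = x
          · subst h2; simp at h'
          linarith [hTpos t ht h1 h2]
    have lwa : HullListAt T ε p (w :: a) := by
      refine ⟨List.pairwise_cons.2 ⟨hwa, sa⟩, ?_, ?_⟩
      · exact List.forall_mem_cons.2 ⟨hwT', fun t ht =>
          (hl.extreme t ((ma t).1 ht).1).mono hTS ((ma t).1 ht).2.1⟩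
      · exact List.forall_mem_cons.2 ⟨hwp, hap⟩
    have path₁ := hA T hTlt p w hpT' hwT' hσw.symm hsumT hlinkT ε _ hε lwa
    have path₂ := hA Y hYlt w q hwY' hqY' hwq hsumY hlink ε _ hε lvd
    have path := path₁.glue path₂ (fun t h1 h2 =>
        ((mY t).1 h2).resolve_right (hdisj t h1))
      (noCrossPts_of_odet (ε := -ε) hYneg (odet_self_right _ _ _) fun t ht => by
        rw [odet_neg]; linarith [huwT t ht]).symm
    have hun : T ∪ Y = S := by
      ext t
      rw [Finset.mem_union]
      refine ⟨fun h => h.elim (fun h => hTS h) fun h => hYS h, fun h => ?_⟩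
      exact (hTU t h).imp_right fun h => Finset.mem_insert_of_mem h
    rw [hun] at path
    have e : cyclicChanges σ (p :: w :: a) = 1 + changes σ (w :: (a ++ [p])) := by
      change changes σ (p :: w :: (a ++ [p])) = _
      rw [changes_cons_cons, if_neg hσw.symm]
    exact path.mono (by omega)
  rcases exists_next_event hG hε hTS hUS ⟨q, hqU⟩ huT hwT huw huwU with
    ⟨e, heT, hew, hepos, heneg⟩ | ⟨o, hoU, hopos, honeg⟩
  · -- the next separating edge `w e`
    have hwe : ∀ t ∈ T, 0 ≤ odet ε w e t := by
      intro t ht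
      by_cases h1 : t = w
      · rw [h1]; simp
      by_cases h2 : t = e
      · rw [h2]; simp
      exact (hepos t ht h1 h2).le
    have hep : e ≠ p := by
      rintro rfl
      have h1 := heneg q hqU
      have h2 := hUT q hqU w hwT hwp
      rw [odet_rot] at h1
      linarith
    have hσe : σ e = σ p := by
      by_contra hc
      have h1 := hwmin e (Finset.mem_filter.2 ⟨heT, hc, w, hwT, heT, hepos, heneg⟩) hew
      rw [odet_rot] at h1
      linarith [heneg q hqU]
    have heU : e ∉ U := hdisj e heT
    have hwe' : σ w ≠ σ e := by rw [hσe]; exact hσw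
    set X := T.erase w with hX
    have mX : ∀ t, t ∈ X ↔ t ≠ w ∧ t ∈ T := fun t => Finset.mem_erase
    have hXT : X ⊆ T := Finset.erase_subset _ _
    have hXlt : X ⊂ S := (Finset.erase_subset _ _).trans_ssubset hTlt
    have heX : e ∈ X := (mX e).2 ⟨hew, heT⟩
    have hpX : p ∈ X := (mX p).2 ⟨hwp.symm, hpT⟩
    have hsumX : ∑ t ∈ X, σ t = σ e := by
      have h1 := Finset.add_sum_erase T σ hwT
      have h2 := color_add hσ hwe'
      rw [← hX] at h1
      omega
    have hXpos : ∀ t ∈ X, t ≠ e → 0 < odet ε w e t := fun t ht h =>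
      hepos t (hXT ht) ((mX t).1 ht).1 h
    have heX' : Extreme X e := extreme_of_support heX (odet_self_right ε w e)
      (fun t ht h1 _ => hXpos t ht h1) (odet_self_right ε w e).ge
    have hpX' : Extreme X p := hp.mono (hXT.trans hTS) hpX
    set b := a.filter (fun t => t ≠ e) with hb
    have mb : ∀ t, t ∈ b ↔ t ∈ a ∧ t ≠ e := fun t => by simp [hb]
    have hab : ∀ t ∈ a, t ∈ X := fun t ht => (mX t).2 ⟨((ma t).1 ht).2.2, ((ma t).1 ht).2.1⟩
    have lb : HullListAt X ε p b := by
      refine ⟨sa.sublist List.filter_sublist, fun t ht => ?_, fun t ht => hap t ((mb t).1 ht).1⟩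
      have h := ((mb t).1 ht).1
      exact (hl.extreme t ((ma t).1 h).1).mono (hXT.trans hTS) (hab t h)
    obtain ⟨b', lb', -, hle⟩ := lb.rebase (hG.mono (hXT.trans hTS)) hε hpX' heX' hep σ
    have hle' := hle (by rw [mb]; tauto)
    have path₁ := (hB X hXlt e p heX' hpX' hep hσe hsumX ε b' hε lb').symm
    obtain ⟨z, hz, hzw, hzf⟩ := hwY'.exists_neighbor hGY hε.neg hqY hqw'
    obtain ⟨hzq, hσz, hlz⟩ := (linkable_or_neighbor hσ hGY hwY' hqY hwq hsumY hz hzw hε.neg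
      hzf).resolve_left hlink
    have hzY : Extreme Y z := extreme_of_support hz (odet_self_right (-ε) w z)
      (fun t ht h1 h2 => hzf t ht h2 h1) (odet_self_outer (-ε) w z).ge
    obtain ⟨d', ld', hled, -⟩ := lvd.rebase hGY hε hwY' hzY hzw σ
    have path₂ := hA Y hYlt z q hzY hqY' (by rw [hσz]; exact hwq) hsumY hlz ε d' hε ld'
    have heY : e ∉ Y := by
      rw [mY]
      rintro (h | h)
      exacts [hew h, heU h]
    have path₃ := path₂.cons heY (by rw [hσz]; exact hwe'.symm)
      (noCrossEdge_of_odet_neg (ε := -ε) (u := w) (v := z) (fun t ht => by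
        by_cases h1 : t = w
        · rw [h1]; simp
        by_cases h2 : t = z
        · rw [h2]; simp
        exact (hzf t ht h1 h2).le) (by
        have := heneg z (((mY z).1 hz).resolve_left hzw)
        rw [odet_swap_right] at this
        rw [odet_neg]; linarith) (odet_self_right _ _ _).le)
    have path := path₁.glue path₃ (fun t h1 h2 => by
        rcases Finset.mem_insert.1 h2 with h | h
        · exact h
        rcases (mY t).1 h with h | h
        · exact (((mX t).1 h1).1 h).elim
        · exact (hdisj t (hXT h1) h).elim)
      (noCrossPts_of_odet (ε := ε) hXpos (odet_self_right _ _ _) fun t ht => by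
        rcases Finset.mem_insert.1 ht with rfl | h
        · simp
        rcases (mY t).1 h with rfl | h
        · simp
        · exact (heneg t h).le)
    have hun : X ∪ insert e Y = S := by
      ext t
      rw [Finset.mem_union, Finset.mem_insert, mX, mY]
      constructor
      · rintro (h | rfl | rfl | h)
        exacts [hTS h.2, hTS heT, hTS hwT, hUS h]
      · intro h
        have := hTU t h
        tauto
    rw [hun] at path
    have hsa : a.Sublist (e :: b) := by
      by_cases hea : e ∈ a
      · refine sublist_of_pairwise (fun _ _ h => odet_asymm h) sa
          (List.pairwise_cons.2 ⟨fun t ht => ?_, lb.sorted⟩) fun t ht => ?_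
        · obtain ⟨h1, h2⟩ := (mb t).1 ht
          exact separated w e heT hep hwe (heneg q hqU) t ((ma t).1 h1).1 ((ma t).1 h1).2.1 h2
        · rw [List.mem_cons, mb]; tauto
      · have : b = a := List.filter_eq_self.2 fun t ht => by
          have : t ≠ e := by rintro rfl; exact hea ht
          simpa using this
        rw [this]; exact List.sublist_cons_self _ _
    have e1 : changes σ (w :: (a ++ [p])) ≤ changes σ (w :: (e :: (b ++ [p]))) :=
      changes_sublist σ (List.Sublist.cons_cons w (List.Sublist.append_right hsa [p]))
    rw [changes_cons_cons, if_neg hwe', changes_congr_head σ hσe] at e1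
    have e2 : cyclicChanges σ (p :: b) = changes σ (p :: (b ++ [p])) := rfl
    exact path.mono (by omega)
  · -- the rotating line meets `o ∈ U`
    have hwo : ∀ t ∈ Y, t ≠ w → t ≠ o → 0 < odet ε w o t := by
      intro t ht h1 h2
      rw [odet_swap]
      linarith [honeg t (((mY t).1 ht).resolve_left h1) h2]
    have hoY : o ∈ Y := Finset.mem_insert_of_mem hoU
    have how : o ≠ w := by rintro rfl; exact hwU hoU
    obtain ⟨hoq, hσo, hlo⟩ := (linkable_or_neighbor hσ hGY hwY' hqY hwq hsumY hoY how hε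
      hwo).resolve_left hlink
    have hσop : σ o ≠ σ p := by rw [hσo]; exact hσw
    have hoT : o ∉ T := fun h => hdisj o h hoU
    have hop : o ≠ p := by rintro rfl; exact hoT hpT
    set X := insert o (T.erase w) with hX
    have mX : ∀ t, t ∈ X ↔ t = o ∨ t ≠ w ∧ t ∈ T := fun t => by simp [hX]
    have hXS : X ⊆ S := by
      intro t ht
      rcases (mX t).1 ht with rfl | h
      exacts [hUS hoU, hTS h.2]
    have hqX : q ∉ X := by
      rw [mX]
      rintro (h | h)
      exacts [hoq h.symm, hqT h.2]
    have hXlt : X ⊂ S := Finset.ssubset_iff_subset_ne.2 ⟨hXS, fun h => hqX (h ▸ hq.1)⟩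
    have hpX' : Extreme X p := hp.mono hXS ((mX p).2 (Or.inr ⟨hwp.symm, hpT⟩))
    have hXpos : ∀ t ∈ X, t ≠ o → 0 < odet ε o w t := by
      intro t ht h
      have := ((mX t).1 ht).resolve_left h
      exact hopos t this.2 this.1
    have hoX : Extreme X o := extreme_of_support ((mX o).2 (Or.inl rfl))
      (odet_self_outer ε o w) (fun t ht h1 _ => hXpos t ht h1) (odet_self_outer ε o w).ge
    have hoY' : Extreme Y o := extreme_of_support hoY (odet_self_right ε w o)
      (fun t ht h1 h2 => hwo t ht h2 h1) (odet_self_outer ε w o).ge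
    have hsumX : ∑ t ∈ X, σ t = 0 := by
      rw [hX, Finset.sum_insert (by simp [hoT]), hσo, Finset.add_sum_erase T σ hwT, hsumT]
    have hoa : ∀ t ∈ a, 0 < odet ε p o t := fun t ht =>
      hUT o hoU t ((ma t).1 ht).2.1 (hap t ht)
    have loa : HullListAt X ε p (o :: a) := by
      refine ⟨List.pairwise_cons.2 ⟨hoa, sa⟩, ?_, ?_⟩
      · exact List.forall_mem_cons.2 ⟨hoX, fun t ht =>
          (hl.extreme t ((ma t).1 ht).1).mono hXS
            ((mX t).2 (Or.inr ⟨((ma t).1 ht).2.2, ((ma t).1 ht).2.1⟩))⟩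
      · exact List.forall_mem_cons.2 ⟨hop, hap⟩
    have path₁ := hA X hXlt p o hpX' hoX hσop.symm hsumX (Or.inl ⟨ε, hε, fun t ht h1 h2 =>
      hUT o hoU t (((mX t).1 ht).resolve_left h2).2 h1⟩) ε _ hε loa
    obtain ⟨d', ld', hled, -⟩ := lvd.rebase hGY hε hwY' hoY' how σ
    have path₂ := hA Y hYlt o q hoY' hqY' (by rw [hσo]; exact hwq) hsumY hlo ε d' hε ld'
    have path := path₁.glue path₂ (fun t h1 h2 => by
        rcases (mX t).1 h1 with h | h
        · exact h
        · exact (((mY t).1 h2).elim h.1 (hdisj t h.2)).elim)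
      (noCrossPts_of_odet (ε := ε) hXpos (odet_self_outer _ _ _) fun t ht => by
        by_cases h1 : t = w
        · rw [h1]; simp
        by_cases h2 : t = o
        · rw [h2]; simp
        exact (honeg t (((mY t).1 ht).resolve_left h1) h2).le)
    have hun : X ∪ Y = S := by
      ext t
      rw [Finset.mem_union, mX, mY]
      constructor
      · rintro ((rfl | h) | rfl | h)
        exacts [hUS hoU, hTS h.2, hTS hwT, hUS h]
      · intro h
        have := hTU t h
        tauto
    rw [hun] at path
    have e : cyclicChanges σ (p :: o :: a) = 1 + changes σ (w :: (a ++ [p])) := by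
      change changes σ (p :: o :: (a ++ [p])) = _
      rw [changes_cons_cons, if_neg hσop.symm, changes_congr_head σ hσo]
    exact path.mono (by omega)

lemma surplusPaths_step {σ : Pt → ℤ} (hσ : ∀ t, σ t = 1 ∨ σ t = -1) {S : Finset Pt}
    (hG : GenPos S) (hA : ∀ T, T ⊂ S → BalancedPaths σ T)
    (hB : ∀ T, T ⊂ S → SurplusPaths σ T) : SurplusPaths σ S := by
  intro p q hp hq hne hpq hS ε l hε hl
  by_cases h : ∀ ε x, IsSign ε → x ∈ S → x ≠ p →
      (∀ t ∈ S, t ≠ p → t ≠ x → 0 < odet ε p x t) → σ x = σ p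
  · exact hasPath_of_neighbors_eq hσ hG hA hB hp hq hne hpq hS h hε hl
  · push Not at h
    obtain ⟨ε', x, hε', hx, -, hnb, hxp⟩ := h
    exact hasPath_of_neighbor_ne hσ hG hA hp hq hne hpq hS hx hε' hnb hxp hε hl

theorem balancedPaths_and_surplusPaths {σ : Pt → ℤ} (hσ : ∀ t, σ t = 1 ∨ σ t = -1)
    (S : Finset Pt) (hG : GenPos S) : BalancedPaths σ S ∧ SurplusPaths σ S := by
  induction S using Finset.strongInduction with
  | H S ih =>
    have hA := fun T hT => (ih T hT (hG.mono hT.subset)).1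
    have hB := fun T hT => (ih T hT (hG.mono hT.subset)).2
    exact ⟨balancedPaths_step hσ hG hA hB, surplusPaths_step hσ hG hA hB⟩

/-- `S` carries a 1-plane Hamiltonian alternating cycle with at least `m` uncrossed edges. -/
def HasCycle (σ : Pt → ℤ) (S : Finset Pt) (m : ℕ) : Prop :=
  ∃ v : List Pt, v.Nodup ∧ v.toFinset = S ∧ (∀ e ∈ cycleEdges v, σ e.1 ≠ σ e.2) ∧
    OnePlaneSet (cycleEdges v).toFinset ∧ m ≤ uncrossed (cycleEdges v).toFinset

lemma cycleEdges_cons (p : Pt) (l : List Pt) :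
    cycleEdges (p :: l) = pathEdges (p :: (l ++ [p])) := by
  have h : (p :: l).length = (l ++ [p]).length := by simp
  have h2 := List.zip_append (l₁ := p :: l) (r₁ := [p]) (l₂ := l ++ [p]) (r₂ := []) h
  simpa [cycleEdges, pathEdges] using h2.symm

lemma nodup_cycleEdges {v : List Pt} (hv : v.Nodup) : (cycleEdges v).Nodup := by
  refine List.Nodup.of_map Prod.fst ?_
  rwa [cycleEdges, List.map_fst_zip (by simp)]

lemma length_cycleEdges (v : List Pt) : (cycleEdges v).length = v.length := by
  simp [cycleEdges]

/-- An edge of a path joining the two end points is the whole path. -/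
lemma eq_nil_of_mem_pathEdges {p x : Pt} {l : List Pt} (hl : (p :: (l ++ [x])).Nodup)
    {e : Pt × Pt} (he : e ∈ pathEdges (p :: (l ++ [x]))) (h1 : e.1 = p ∨ e.1 = x)
    (h2 : e.2 = p ∨ e.2 = x) : l = [] := by
  cases l with
  | nil => rfl
  | cons a l =>
    exfalso
    have hne := ne_of_mem_pathEdges hl he
    have he' : e ∈ (p, a) :: pathEdges (a :: (l ++ [x])) := he
    simp only [List.cons_append, List.nodup_cons, List.mem_cons, List.mem_append,
      List.not_mem_nil, or_false, not_or] at hl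
    rcases List.mem_cons.1 he' with rfl | he'
    · rcases h2 with h2 | h2
      · exact hl.1.1 h2.symm
      · exact hl.2.1.2 h2
    · have key : ∀ t ∈ a :: (l ++ [x]), t ≠ p := by
        rintro t ht rfl
        simp only [List.mem_cons, List.mem_append, List.not_mem_nil, or_false] at ht
        tauto
      have := mem_of_mem_pathEdges he'
      exact hne ((h1.resolve_left (key _ this.1)).trans (h2.resolve_left (key _ this.2)).symm)

/-- Two paths with common end points on opposite sides of the line through them form a cycle. -/
lemma HasPath.close {σ : Pt → ℤ} {X Y : Finset Pt} {p x : Pt} {m₁ m₂ : ℕ} {ε : ℝ}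
    (h₁ : HasPath σ X p x m₁) (h₂ : HasPath σ Y x p m₂)
    (hX : ∀ t ∈ X, t ≠ p → t ≠ x → 0 < odet ε p x t)
    (hY : ∀ t ∈ Y, t ≠ p → t ≠ x → odet ε p x t < 0)
    (hne : ∃ t ∈ X ∪ Y, t ≠ p ∧ t ≠ x) : HasCycle σ (X ∪ Y) (m₁ + m₂) := by
  obtain ⟨l, nl, cl, al, ol, ul⟩ := h₁
  obtain ⟨k, nk, ck, ak, ok, uk⟩ := h₂
  have hE : cycleEdges (p :: (l ++ x :: k)) =
      pathEdges (p :: (l ++ [x])) ++ pathEdges (x :: (k ++ [p])) := by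
    have h := pathEdges_append (p :: l) (k ++ [p]) x
    rw [cycleEdges_cons]
    simpa using h
  have memX : ∀ {t}, t ∈ p :: (l ++ [x]) → t ∈ X := fun h => by
    rw [← cl]; exact List.mem_toFinset.2 h
  have memY : ∀ {t}, t ∈ x :: (k ++ [p]) → t ∈ Y := fun h => by
    rw [← ck]; exact List.mem_toFinset.2 h
  have posX : ∀ t ∈ X, 0 ≤ odet ε p x t := fun t ht => by
    by_cases h1 : t = p
    · simp [h1]
    by_cases h2 : t = x
    · simp [h2]
    exact (hX t ht h1 h2).le
  have negY : ∀ t ∈ Y, odet ε p x t ≤ 0 := fun t ht => by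
    by_cases h1 : t = p
    · simp [h1]
    by_cases h2 : t = x
    · simp [h2]
    exact (hY t ht h1 h2).le
  have hNC : NoCross (pathEdges (p :: (l ++ [x]))).toFinset
      (pathEdges (x :: (k ++ [p]))).toFinset := by
    intro e he f hf
    rw [List.mem_toFinset] at he hf
    have e1 := memX (mem_of_mem_pathEdges he).1
    have e2 := memX (mem_of_mem_pathEdges he).2
    have f1 := memY (mem_of_mem_pathEdges hf).1
    have f2 := memY (mem_of_mem_pathEdges hf).2
    refine not_segCross_of_odet (posX _ e1) (posX _ e2) (negY _ f1) (negY _ f2) ?_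
    by_contra! hcon
    have onX : ∀ t ∈ X, odet ε p x t ≤ 0 → t = p ∨ t = x := fun t ht h => by
      by_contra! h'
      exact absurd (hX t ht h'.1 h'.2) (not_lt.2 h)
    have onY : ∀ t ∈ Y, 0 ≤ odet ε p x t → t = p ∨ t = x := fun t ht h => by
      by_contra! h'
      exact absurd (hY t ht h'.1 h'.2) (not_lt.2 h)
    have hl := eq_nil_of_mem_pathEdges nl he (onX _ e1 hcon.1) (onX _ e2 hcon.2.1)
    have hk := eq_nil_of_mem_pathEdges nk hf (onY _ f1 hcon.2.2.1).symm
      (onY _ f2 hcon.2.2.2).symm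
    obtain ⟨t, ht, htp, htx⟩ := hne
    rw [← cl, ← ck, hl, hk] at ht
    simp [htp, htx] at ht
  refine ⟨p :: (l ++ x :: k), ?_, ?_, ?_, ?_, ?_⟩
  · simp only [List.nodup_cons, List.nodup_append, List.mem_append, List.mem_cons,
      List.not_mem_nil, or_false, not_or] at nl nk ⊢
    refine ⟨⟨nl.1.1, nl.1.2, fun h => nk.2.2.2 p h p rfl rfl⟩, nl.2.1,
      ⟨nk.1.1, nk.2.1⟩, ?_⟩
    rintro a ha b (rfl | hb) rfl
    · exact nl.2.2.2 a ha a rfl rfl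
    · have hax : a ≠ x := by rintro rfl; exact nl.2.2.2 a ha a rfl rfl
      have hap : a ≠ p := by rintro rfl; exact nl.1.1 ha
      have h1 := hX a (memX (by simp [ha])) hap hax
      have h2 := hY a (memY (by simp [hb])) hap hax
      linarith
  · rw [← cl, ← ck]
    ext t
    simp only [List.mem_toFinset, List.mem_cons, List.mem_append, Finset.mem_union,
      List.not_mem_nil, or_false]
    tauto
  · intro e he
    rw [hE, List.mem_append] at he
    exact he.elim (al e) (ak e)
  · rw [hE, List.toFinset_append]
    exact hNC.onePlaneSet_union ol ok
  · rw [hE, List.toFinset_append, hNC.uncrossed_union]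
    omega

lemma hasCycle_of_hullListAt {σ : Pt → ℤ} (hσ : ∀ t, σ t = 1 ∨ σ t = -1) {S : Finset Pt}
    (hG : GenPos S) (hS : ∑ t ∈ S, σ t = 0) (hcard : 2 < S.card) {p : Pt} (hp : Extreme S p)
    {ε : ℝ} (hε : IsSign ε) {l : List Pt} (hl : HullListAt S ε p l) :
    HasCycle σ S (max 2 (cyclicChanges σ (p :: l))) := by
  obtain ⟨x, hxF, hxp, hH⟩ := exists_cut hG hσ hp hε (S.erase p) subset_rfl
    (fun t _ t' ht' h => Finset.mem_erase.2 ⟨by rintro rfl; simp at h, ht'⟩) (by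
      have := Finset.add_sum_erase S σ hp.1
      have h2 : ∑ t ∈ S.erase p, σ t = -σ p := by omega
      rw [h2]
      rcases hσ p with h | h <;> rw [h] <;> norm_num)
  obtain ⟨hne, hx⟩ := Finset.mem_erase.1 hxF
  have hN := sum_cut hG hε hp.1 hx hne.symm σ
  rw [hS, hH, color_add hσ hxp.symm] at hN
  set H := S.filter (fun t => 0 < odet ε p x t) with hHdef
  set N := S.filter (fun t => odet ε p x t < 0) with hNdef
  have hN : ∑ t ∈ N, σ t = 0 := by omega
  have mH : ∀ t, t ∈ H ↔ t ∈ S ∧ 0 < odet ε p x t := fun t => by simp [hHdef]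
  have mN : ∀ t, t ∈ N ↔ t ∈ S ∧ odet ε p x t < 0 := fun t => by simp [hNdef]
  set X := insert p (insert x H) with hXdef
  set Y := insert p (insert x N) with hYdef
  have hXS : X ⊆ S := by
    simp only [hXdef, Finset.insert_subset_iff]
    exact ⟨hp.1, hx, fun t h => ((mH t).1 h).1⟩
  have hYS : Y ⊆ S := by
    simp only [hYdef, Finset.insert_subset_iff]
    exact ⟨hp.1, hx, fun t h => ((mN t).1 h).1⟩
  have hXY : X ∪ Y = S := by
    refine (Finset.union_subset hXS hYS).antisymm fun t ht => ?_
    rcases cut_cases hG hε hp.1 hx hne.symm ht with h | h | h | h <;>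
      simp [hXdef, hYdef, mH, mN, h, ht]
  have sideX : ∀ t ∈ X, t ≠ p → t ≠ x → 0 < odet ε p x t := fun t ht h1 h2 =>
    ((mH t).1 (by simpa [hXdef, h1, h2] using ht)).2
  have sideY : ∀ t ∈ Y, t ≠ p → t ≠ x → odet ε p x t < 0 := fun t ht h1 h2 =>
    ((mN t).1 (by simpa [hYdef, h1, h2] using ht)).2
  have sideY' : ∀ t ∈ Y, t ≠ p → t ≠ x → 0 < odet (-ε) p x t := fun t ht h1 h2 => by
    rw [odet_neg]; linarith [sideY t ht h1 h2]
  have sX : ∑ t ∈ X, σ t = 0 := by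
    rw [hXdef, Finset.sum_insert (by simp [mH, hne.symm]), Finset.sum_insert (by simp [mH]), hH,
      ← add_assoc, color_add hσ hxp.symm, add_zero]
  have sY : ∑ t ∈ Y, σ t = 0 := by
    rw [hYdef, Finset.sum_insert (by simp [mN, hne.symm]), Finset.sum_insert (by simp [mN]), hN,
      ← add_assoc, color_add hσ hxp.symm, add_zero]
  have pX : p ∈ X := by simp [hXdef]
  have xX : x ∈ X := by simp [hXdef]
  have pY : p ∈ Y := by simp [hYdef]
  have xY : x ∈ Y := by simp [hYdef]
  have exX : Extreme X x := extreme_of_support xX (x₀ := p) (by simp)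
    (fun t ht h1 h2 => sideX t ht h2 h1) (by simp)
  have exY : Extreme Y x := extreme_of_support xY (x₀ := p) (by simp)
    (fun t ht h1 h2 => sideY' t ht h2 h1) (by simp)
  set a := l.filter fun t => 0 < odet ε p x t with ha
  set b := l.filter fun t => odet ε p x t < 0 with hb
  have la : HullListAt X ε p a := hl.filter hXS _ fun t ht h => by
    simp [hXdef, mH, (hl.extreme t ht).1, h]
  have lb : HullListAt Y ε p b := hl.filter hYS _ fun t ht h => by
    simp [hYdef, mN, (hl.extreme t ht).1, h]
  have ma : ∀ t ∈ a, 0 < odet ε p x t := fun t ht => by simpa using (List.mem_filter.1 ht).2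
  have mb : ∀ t ∈ b, 0 < odet ε p t x := fun t ht => by
    rw [odet_swap_right]
    have : odet ε p x t < 0 := by simpa using (List.mem_filter.1 ht).2
    linarith
  have la' : HullListAt X ε p (x :: a) :=
    ⟨List.pairwise_cons.2 ⟨ma, la.sorted⟩, List.forall_mem_cons.2 ⟨exX, la.extreme⟩,
      List.forall_mem_cons.2 ⟨hne, la.ne⟩⟩
  have lb' : HullListAt Y ε p (b ++ [x]) :=
    ⟨List.pairwise_append.2 ⟨lb.sorted, by simp, by simpa using mb⟩,
      List.forall_mem_append.2 ⟨lb.extreme, by simpa using exY⟩,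
      List.forall_mem_append.2 ⟨lb.ne, by simpa using hne⟩⟩
  have hsub : l.Sublist (b ++ x :: a) := by
    refine hl.sublist (List.pairwise_append.2 ⟨lb.sorted, la'.sorted, fun t ht u hu => ?_⟩) ?_
    · rcases List.mem_cons.1 hu with rfl | hu
      · exact mb t ht
      · exact hp.odet_trans hG hε (hYS (lb.extreme t ht).1) hx (hXS (la.extreme u hu).1)
          (mb t ht) (ma u hu)
    · intro t ht
      have hc := cut_cases hG hε hp.1 hx hne.symm (hl.extreme t ht).1
      have := hl.ne t ht
      simp only [List.mem_append, List.mem_cons, ha, hb, List.mem_filter, decide_eq_true_eq]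
      tauto
  have path₁ := (balancedPaths_and_surplusPaths hσ X (hG.mono hXS)).1 p x
    (hp.mono hXS pX) exX hxp.symm sX (Or.inl ⟨ε, hε, sideX⟩) ε _ hε la'
  have path₂ := (balancedPaths_and_surplusPaths hσ Y (hG.mono hYS)).1 p x
    (hp.mono hYS pY) exY hxp.symm sY (Or.inl ⟨-ε, hε.neg, sideY'⟩) ε _ hε lb'
  have hcyc := path₁.close path₂.symm sideX sideY (by
    rw [hXY]
    by_contra! hcon
    have : S ⊆ {p, x} := fun t ht => by
      by_cases h : t = p
      · simp [h]
      · simp [hcon t ht h]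
    have := Finset.card_le_card this
    have := Finset.card_le_two (a := p) (b := x)
    omega)
  rw [hXY] at hcyc
  have e₁ : cyclicChanges σ (p :: x :: a) = 1 + changes σ (x :: (a ++ [p])) := by
    change changes σ (p :: x :: (a ++ [p])) = _
    rw [changes_cons_cons, if_neg hxp.symm]
  have e₂ : cyclicChanges σ (p :: (b ++ [x])) = changes σ (p :: (b ++ [x])) + 1 := by
    simpa [cyclicChanges, changes, hxp] using changes_append σ (p :: b) [p] x
  have e₃ : cyclicChanges σ (p :: (b ++ x :: a)) =
      changes σ (p :: (b ++ [x])) + changes σ (x :: (a ++ [p])) := by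
    simpa [cyclicChanges] using changes_append σ (p :: b) (a ++ [p]) x
  have e₄ := cyclicChanges_sublist σ (hsub.cons_cons p)
  have e₅ : changes σ [p, x] ≤ changes σ (p :: (b ++ [x])) := changes_sublist σ (by simp)
  have e₆ : changes σ [x, p] ≤ changes σ (x :: (a ++ [p])) := changes_sublist σ (by simp)
  simp only [changes, hxp, hxp.symm, if_false] at e₅ e₆
  obtain ⟨v, h1, h2, h3, h4, h5⟩ := hcyc
  exact ⟨v, h1, h2, h3, h4, by omega⟩

section Counting

variable {E : List (Pt × Pt)}

lemma edgeCrossCount_eq_edgeDeg (hE : E.Nodup) {i : ℕ} (hi : i < E.length) :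
    edgeCrossCount E i = edgeDeg E.toFinset (E.getD i ((0, 0), (0, 0))) := by
  have inj : ∀ a < E.length, ∀ b < E.length,
      E.getD a ((0, 0), (0, 0)) = E.getD b ((0, 0), (0, 0)) → a = b := fun a ha b hb h => by
    rwa [List.getD_eq_getElem _ _ ha, List.getD_eq_getElem _ _ hb, hE.getElem_inj_iff] at h
  unfold edgeCrossCount edgeDeg
  refine Finset.card_bij (fun j _ => E.getD j ((0, 0), (0, 0))) ?_ ?_ ?_
  · intro j hj
    rw [Finset.mem_filter, Finset.mem_range] at hj
    refine Finset.mem_filter.2 ⟨?_, fun h => hj.2.1 (inj _ hj.1 _ hi h), hj.2.2⟩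
    rw [List.mem_toFinset, List.getD_eq_getElem _ _ hj.1]
    exact List.getElem_mem _
  · intro a ha b hb h
    exact inj a (Finset.mem_range.1 (Finset.mem_filter.1 ha).1) b
      (Finset.mem_range.1 (Finset.mem_filter.1 hb).1) h
  · intro f hf
    rw [Finset.mem_filter, List.mem_toFinset] at hf
    obtain ⟨⟨j, hj, rfl⟩, h1, h2⟩ := And.imp_left List.mem_iff_getElem.1 hf
    refine ⟨j, ?_, List.getD_eq_getElem _ _ hj⟩
    rw [Finset.mem_filter, Finset.mem_range, List.getD_eq_getElem _ _ hj]
    refine ⟨hj, ?_, h2⟩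
    rintro rfl
    exact h1 (List.getD_eq_getElem _ _ hj).symm

lemma onePlane_of_onePlaneSet (hE : E.Nodup) (h : OnePlaneSet E.toFinset) : OnePlane E := by
  intro i hi
  have hi := Finset.mem_range.1 hi
  rw [edgeCrossCount_eq_edgeDeg hE hi]
  refine h _ ?_
  rw [List.mem_toFinset, List.getD_eq_getElem _ _ hi]
  exact List.getElem_mem _

lemma sum_edgeCrossCount (E : List (Pt × Pt)) :
    ∑ i ∈ Finset.range E.length, edgeCrossCount E i = 2 * crossNum E := by
  set e := fun i => E.getD i ((0, 0), (0, 0)) with he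
  set c : ℕ → ℕ → ℕ := fun i j => if i < j ∧ SegCross (e i) (e j) then 1 else 0 with hc
  have h1 : crossNum E = ∑ i ∈ Finset.range E.length, ∑ j ∈ Finset.range E.length, c i j := by
    rw [crossNum, Finset.card_filter, Finset.sum_product]
  have h2 : ∀ i, edgeCrossCount E i = ∑ j ∈ Finset.range E.length, (c i j + c j i) := by
    intro i
    rw [edgeCrossCount, Finset.card_filter]
    refine Finset.sum_congr rfl fun j _ => ?_
    have hs : SegCross (e j) (e i) ↔ SegCross (e i) (e j) := ⟨segCross_comm, segCross_comm⟩
    simp only [hc, hs]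
    rcases lt_trichotomy i j with h | h | h
    · simp [h, h.ne', h.not_gt, he]
    · simp [h]
    · simp [h, h.ne, h.not_gt, he]
  simp only [h2, Finset.sum_add_distrib]
  rw [Finset.sum_comm (f := fun i j => c j i), ← h1]
  ring

lemma two_mul_crossNum_add_uncrossed_le (hE : E.Nodup) (h : OnePlaneSet E.toFinset) :
    2 * crossNum E + uncrossed E.toFinset ≤ E.length := by
  have h1 : ∑ i ∈ Finset.range E.length, edgeCrossCount E i =
      ∑ e ∈ E.toFinset, edgeDeg E.toFinset e := by
    rw [List.sum_toFinset _ hE, Finset.sum_range, ← Fin.sum_univ_fun_getElem]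
    refine Finset.sum_congr rfl fun i _ => ?_
    rw [edgeCrossCount_eq_edgeDeg hE i.2, List.getD_eq_getElem _ _ i.2]
  have h2 : ∑ e ∈ E.toFinset, edgeDeg E.toFinset e + uncrossed E.toFinset ≤ E.toFinset.card := by
    rw [uncrossed, Finset.card_filter, ← Finset.sum_add_distrib, Finset.card_eq_sum_ones]
    refine Finset.sum_le_sum fun e he => ?_
    have := h e he
    split_ifs <;> omega
  rw [List.toFinset_card_of_nodup hE] at h2
  rw [← sum_edgeCrossCount, h1]
  exact h2

end Counting

/-- Each maximal run of the sign `s` is entered once and left once. -/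
lemma two_mul_card_runs {σ : Pt → ℤ} (hσ : ∀ t, σ t = 1 ∨ σ t = -1) {s : ℤ}
    (hs : s = 1 ∨ s = -1) {k : ℕ} (hk : 0 < k + 1) (pt : Fin (k + 1) → Pt) :
    2 * (Finset.univ.filter fun i => σ (pt i) = s ∧ σ (pt (cycPred hk i)) = -s).card =
      cyclicChanges σ (List.ofFn pt) := by
  have hch : ∀ (k : ℕ) (f : Fin (k + 1) → Pt), changes σ (List.ofFn f) =
      ∑ i : Fin k, if σ (f i.castSucc) = σ (f i.succ) then 0 else 1 := by
    intro k
    induction k with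
    | zero => intro f; simp [changes]
    | succ k ih =>
      intro f
      have h := ih fun i => f i.succ
      rw [List.ofFn_succ] at h
      rw [List.ofFn_succ, List.ofFn_succ, changes_cons_cons, h, Fin.sum_univ_succ]
      rfl
  have hcyc : cyclicChanges σ (List.ofFn pt) =
      ∑ i, if σ (pt (cycPred hk i)) = σ (pt i) then 0 else 1 := by
    have hlast : pt (cycPred hk 0) = pt (Fin.last k) := by
      congr 1; ext; simp [cycPred]
    have hsucc : ∀ i : Fin k, cycPred hk i.succ = i.castSucc := fun i => by
      ext
      simp only [cycPred, Fin.val_succ, Fin.val_castSucc]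
      have : i.val + 1 + (k + 1 - 1) = i.val + (k + 1) := by omega
      rw [this, Nat.add_mod_right, Nat.mod_eq_of_lt (by omega)]
    rw [Fin.sum_univ_succ, hlast]
    simp only [hsucc]
    rw [← hch k pt]
    have h := changes_append σ (List.ofFn fun i => pt (Fin.castSucc i)) [pt 0] (pt (Fin.last k))
    have h' := List.ofFn_succ' pt
    rw [List.concat_eq_append] at h'
    rw [← h', ← List.singleton_append, ← List.append_assoc, ← h', List.ofFn_succ] at h
    rw [List.ofFn_succ]
    simpa [cyclicChanges, changes, add_comm] using h
  have hbij : Function.Bijective (cycPred hk : Fin (k + 1) → Fin (k + 1)) := by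
    refine Finite.injective_iff_bijective.1 fun i j h => ?_
    have h := congrArg Fin.val h
    simp only [cycPred] at h
    have := Nat.ModEq.add_right_cancel' _ h
    ext
    simpa [Nat.ModEq, Nat.mod_eq_of_lt i.2, Nat.mod_eq_of_lt j.2] using this
  have htel : ∑ i, (σ (pt i) - σ (pt (cycPred hk i))) = 0 := by
    rw [Finset.sum_sub_distrib, hbij.sum_comp fun i => σ (pt i), sub_self]
  have key : (4 : ℤ) * ∑ i, (if σ (pt i) = s ∧ σ (pt (cycPred hk i)) = -s then 1 else 0) =
      2 * ∑ i, (if σ (pt (cycPred hk i)) = σ (pt i) then 0 else 1) +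
        s * ∑ i, (σ (pt i) - σ (pt (cycPred hk i))) := by
    simp only [Finset.mul_sum, ← Finset.sum_add_distrib]
    refine Finset.sum_congr rfl fun i _ => ?_
    rcases hs with rfl | rfl <;> rcases hσ (pt i) with h1 | h1 <;>
      rcases hσ (pt (cycPred hk i)) with h2 | h2 <;> rw [h1, h2] <;> norm_num
  rw [htel, mul_zero, add_zero] at key
  rw [hcyc, Finset.card_filter]
  zify
  linarith

lemma exists_extreme {S : Finset Pt} (hS : S.Nonempty) : ∃ p, Extreme S p := by
  obtain ⟨p, hp, hmin⟩ := S.exists_min_image Prod.fst hS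
  refine ⟨p, hp, fun a ha b hb c hc ⟨h1, h2, h3⟩ => ?_⟩
  have ha := sub_nonneg.2 (hmin a ha)
  have hb := sub_nonneg.2 (hmin b hb)
  have hc := sub_nonneg.2 (hmin c hc)
  have hsum : det2 p b c * (a.1 - p.1) + det2 p c a * (b.1 - p.1) + det2 p a b * (c.1 - p.1)
      = 0 := by unfold det2; ring
  have ha' := mul_nonneg h2.le ha
  have hb' := mul_nonneg h3.le hb
  have hc' := mul_nonneg h1.le hc
  have ha0 : a.1 - p.1 = 0 := by
    rcases mul_eq_zero.1 (by linarith : det2 p b c * (a.1 - p.1) = 0) with h | h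
    · linarith
    · exact h
  have hb0 : b.1 - p.1 = 0 := by
    rcases mul_eq_zero.1 (by linarith : det2 p c a * (b.1 - p.1) = 0) with h | h
    · linarith
    · exact h
  simp [det2, ha0, hb0] at h1

lemma extreme_of_mem_hullPts {S : Finset Pt} {p : Pt} (hp : p ∈ hullPts S) : Extreme S p := by
  obtain ⟨hpS, hp⟩ := Finset.mem_filter.1 hp
  refine ⟨hpS, fun a ha b hb c hc ⟨h1, h2, h3⟩ => hp ?_⟩
  have ne : ∀ {u v}, 0 < det2 p u v → u ≠ p ∧ v ≠ p := fun {u v} h =>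
    ⟨by rintro rfl; simp [det2] at h, by rintro rfl; simp [det2] at h⟩
  have mem : ∀ {t}, t ∈ S → t ≠ p → t ∈ convexHull ℝ ((S.erase p : Finset Pt) : Set Pt) :=
    fun ht h => subset_convexHull _ _ (Finset.mem_coe.2 (Finset.mem_erase.2 ⟨h, ht⟩))
  have hD : 0 < det2 p b c + det2 p c a + det2 p a b := by positivity
  have hconv := (convex_convexHull ℝ ((S.erase p : Finset Pt) : Set Pt)).sum_mem
    (t := Finset.univ)
    (w := ![det2 p b c / (det2 p b c + det2 p c a + det2 p a b),
      det2 p c a / (det2 p b c + det2 p c a + det2 p a b),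
      det2 p a b / (det2 p b c + det2 p c a + det2 p a b)]) (z := ![a, b, c])
    (by intro i _; fin_cases i <;> simp <;> positivity)
    (by simp [Fin.sum_univ_three]; field_simp)
    (by intro i _; fin_cases i; exacts [mem ha (ne h1).1, mem hb (ne h2).1, mem hc (ne h3).1])
  convert hconv using 1
  simp only [Fin.sum_univ_three, Matrix.cons_val]
  ext
  · simp only [Prod.fst_add, Prod.smul_fst, smul_eq_mul]
    field_simp
    unfold det2; ring
  · simp only [Prod.snd_add, Prod.smul_snd, smul_eq_mul]
    field_simp
    unfold det2; ring

lemma genPos_of_generalPosition {S : Finset Pt} (h : GeneralPosition S) : GenPos S := by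
  intro a ha b hb c hc hab hac hbc h0
  refine h a ha b hb c hc hab hac hbc ?_
  rw [collinear_iff_of_mem (p₀ := a) (by simp)]
  refine ⟨b - a, ?_⟩
  simp only [Set.mem_insert_iff, Set.mem_singleton_iff, forall_eq_or_imp, forall_eq]
  refine ⟨⟨0, by simp⟩, ⟨1, by simp⟩, ?_⟩
  unfold det2 at h0
  by_cases h1 : b.1 - a.1 = 0
  · have h2 : b.2 - a.2 ≠ 0 := fun h2 => hab (Prod.ext (by linarith) (by linarith))
    refine ⟨(c.2 - a.2) / (b.2 - a.2), Prod.ext ?_ ?_⟩ <;> simp <;> field_simp <;> linarith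
  · refine ⟨(c.1 - a.1) / (b.1 - a.1), Prod.ext ?_ ?_⟩ <;> simp <;> field_simp <;> linarith

lemma IsHullList.hullListAt {S : Finset Pt} {k : ℕ} {pt : Fin (k + 1) → Pt}
    (h : IsHullList S pt) :
    Extreme S (pt 0) ∧ HullListAt S (-1) (pt 0) (List.ofFn fun i : Fin k => pt i.succ) := by
  have ext : ∀ i, Extreme S (pt i) := fun i =>
    extreme_of_mem_hullPts (h.2 ▸ Finset.mem_image_of_mem pt (Finset.mem_univ i))
  refine ⟨ext 0, ?_, ?_, ?_⟩
  · refine List.pairwise_ofFn.2 fun i j hij => ?_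
    have := h.1.2 0 i.succ j.succ (Fin.succ_pos i) (Fin.succ_lt_succ_iff.2 hij)
    unfold odet
    linarith
  · intro a ha
    obtain ⟨i, rfl⟩ := List.mem_ofFn.1 ha
    exact ext _
  · intro a ha
    obtain ⟨i, rfl⟩ := List.mem_ofFn.1 ha
    exact fun h0 => Fin.succ_ne_zero i (h.1.1 h0)

lemma two_mul_runCount_le {σ : Pt → ℤ} (hσ : ∀ t, σ t = 1 ∨ σ t = -1) {s : ℤ}
    (hs : s = 1 ∨ s = -1) {A C : Finset Pt} (hA : ∀ t ∈ A, σ t = s) (hC : ∀ t ∈ C, σ t = -s)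
    {k : ℕ} (hk : 0 < k + 1) (pt : Fin (k + 1) → Pt) :
    2 * runCount hk A C pt ≤ max 2 (cyclicChanges σ (List.ofFn pt)) := by
  unfold runCount
  split_ifs
  · exact le_max_left _ _
  · rw [← two_mul_card_runs hσ hs hk pt]
    refine le_max_of_le_right (Nat.mul_le_mul_left 2 (Finset.card_le_card ?_))
    exact Finset.monotone_filter_right _ fun i _ h => ⟨hA _ h.1, hC _ h.2⟩

/-- Theorem 2.5: for `S = R ∪ B` in general position with `|R| = |B| = n ≥ 2`, there
exists a 1-plane Hamiltonian alternating cycle on `S` with at most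
`n − max {r(S), b(S)}` crossings. -/
theorem stmt5 (n : ℕ) (hn : 2 ≤ n) (R B : Finset Pt)
    (hdisj : Disjoint R B)
    (hgp : GeneralPosition (R ∪ B))
    (hR : R.card = n) (hB : B.card = n) :
    ∃ C : HamAltCycle R B,
      OnePlane (cycleEdges C.verts) ∧
      ∀ (m : ℕ) (hm : 0 < m) (pt : Fin m → Pt), IsHullList (R ∪ B) pt →
        crossNum (cycleEdges C.verts) ≤
          n - max (runCount hm R B pt) (runCount hm B R pt) := by
  set S := R ∪ B with hSdef
  set σ : Pt → ℤ := fun t => if t ∈ R then 1 else -1 with hσdef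
  have hσ : ∀ t, σ t = 1 ∨ σ t = -1 := fun t => by
    by_cases h : t ∈ R <;> simp [hσdef, h]
  have σR : ∀ t ∈ R, σ t = 1 := fun t h => by simp [hσdef, h]
  have σB : ∀ t ∈ B, σ t = -1 := fun t h => by
    simp [hσdef, Finset.disjoint_right.1 hdisj h]
  have hS : ∑ t ∈ S, σ t = 0 := by
    rw [hSdef, Finset.sum_union hdisj, Finset.sum_congr rfl σR, Finset.sum_congr rfl σB]
    simp [hR, hB]
  have hcard : S.card = 2 * n := by
    rw [hSdef, Finset.card_union_of_disjoint hdisj, hR, hB]; ring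
  have hG := genPos_of_generalPosition hgp
  have hcyc := fun {p ε l} (hp : Extreme S p) (hε : IsSign ε) (hl : HullListAt S ε p l) =>
    hasCycle_of_hullListAt hσ hG hS (by omega) hp hε hl
  have hbound : ∀ m, HasCycle σ S m → m ≤ 2 * n := by
    rintro m ⟨v, hv, hvS, -, -, hm⟩
    rw [← hcard, ← hvS, List.toFinset_card_of_nodup hv, ← length_cycleEdges,
      ← List.toFinset_card_of_nodup (nodup_cycleEdges hv)]
    exact hm.trans (Finset.card_filter_le _ _)
  -- take a cycle with the largest number of uncrossed edges
  obtain ⟨M, hM, hmax⟩ : ∃ M, HasCycle σ S M ∧ ∀ m, HasCycle σ S m → m ≤ M := by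
    obtain ⟨p, hp⟩ := exists_extreme (Finset.card_pos.1 (by omega : 0 < S.card))
    have h0 := hcyc hp (Or.inl rfl) (⟨by simp, by simp, by simp⟩ : HullListAt S 1 p [])
    exact ⟨Nat.findGreatest (HasCycle σ S) (2 * n), Nat.findGreatest_spec (hbound _ h0) h0,
      fun m hm => Nat.le_findGreatest (hbound m hm) hm⟩
  obtain ⟨v, hv, hvS, halt, hone, hunc⟩ := hM
  have hE := nodup_cycleEdges hv
  have hlen : (cycleEdges v).length = 2 * n := by
    rw [length_cycleEdges, ← List.toFinset_card_of_nodup hv, hvS, hcard]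
  have hcross := two_mul_crossNum_add_uncrossed_le hE hone
  refine ⟨⟨v, hv, hvS, fun e he => ?_⟩, onePlane_of_onePlaneSet hE hone, ?_⟩
  · have hmem := List.of_mem_zip he
    rw [List.mem_rotate, ← List.mem_toFinset, ← List.mem_toFinset, hvS, hSdef, Finset.mem_union,
      Finset.mem_union] at hmem
    have hne := halt e he
    rcases hmem.1 with h1 | h1 <;> rcases hmem.2 with h2 | h2
    · simp [σR, h1, h2] at hne
    · exact Or.inl ⟨h1, h2⟩
    · exact Or.inr ⟨h1, h2⟩
    · exact absurd ((σB _ h1).trans (σB _ h2).symm) hne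
  · intro m hm pt hpt
    obtain ⟨k, rfl⟩ : ∃ k, m = k + 1 := ⟨m - 1, by omega⟩
    obtain ⟨hext, hlist⟩ := hpt.hullListAt
    have h0 := hmax _ (hcyc hext (Or.inr rfl) hlist)
    rw [← List.ofFn_succ] at h0
    have h1 := two_mul_runCount_le hσ (Or.inl rfl) σR σB hm pt
    have h2 := two_mul_runCount_le hσ (Or.inr rfl) σB (by simpa using σR) hm pt
    change crossNum (cycleEdges v) ≤ _
    omega
end
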